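/- Assume additionally that g = −f (so the domain Ω_{R0} is symmetric with respect to x_n). There exists a constant C > 0, depending only on n, γ, R0, c1, c2 (in particular independent of ε), such that for every ε ∈ (0, R0/4), every f as in the setting with g = −f, and every solution u of the local Robin problem with constants U1 and U2 = −U1 which is odd in x_n, i.e. u(x', −x_n) = −u(x', x_n) for all (x', x_n) ∈ Ω_{R0}, one has |∇u(x)| ≤ C ( sup_{Ω_{R0}} |u| + |U1| ) for all x ∈ Ω_{R0/2}. -/

import Mathlib

open MeasureTheory Metric Set
open scoped RealInnerProductSpace ENNReal

noncomputable section

/-- `n`-dimensional Euclidean space. -/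
abbrev E (k : ℕ) := EuclideanSpace ℝ (Fin k)

/-- Laplacian: sum of pure second directional derivatives. -/
def elap {k : ℕ} (u : E k → ℝ) (x : E k) : ℝ :=
  ∑ i : Fin k, iteratedFDeriv ℝ 2 u x ![EuclideanSpace.single i 1, EuclideanSpace.single i 1]

/-- The horizontal part `x'` of `x = (x', x_n)`. -/
def epre {m : ℕ} (x : E (m+1)) : E m :=
  (EuclideanSpace.equiv (Fin m) ℝ).symm fun i => x i.castSucc

/-- The vertical (last) coordinate `x_n` of `x = (x', x_n)`. -/
def lastC {m : ℕ} (x : E (m+1)) : ℝ := x (Fin.last m)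

/-- Assemble the point `(p, t)`. -/
def eglue {m : ℕ} (p : E m) (t : ℝ) : E (m+1) :=
  (EuclideanSpace.equiv (Fin (m+1)) ℝ).symm fun i => Fin.lastCases t (fun j => p j) i

/-- The narrow region `Ω_{x0',r}`. -/
def neck {m : ℕ} (ε : ℝ) (f g : E m → ℝ) (x0 : E m) (r : ℝ) : Set (E (m+1)) :=
  {x | ‖epre x - x0‖ < r ∧ -(ε/2) + g (epre x) < lastC x ∧ lastC x < ε/2 + f (epre x)}

/-- The upper boundary `Γ₊`. -/
def gammaP {m : ℕ} (ε R0 : ℝ) (f : E m → ℝ) : Set (E (m+1)) :=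
  (fun p => eglue p (ε/2 + f p)) '' ball (0 : E m) R0

/-- The lower boundary `Γ₋`. -/
def gammaM {m : ℕ} (ε R0 : ℝ) (g : E m → ℝ) : Set (E (m+1)) :=
  (fun p => eglue p (-(ε/2) + g p)) '' ball (0 : E m) R0

/-- The unit normal on `Γ₊` (pointing upward). -/
def nuP {m : ℕ} (f : E m → ℝ) (p : E m) : E (m+1) :=
  (Real.sqrt (1 + ‖gradient f p‖^2))⁻¹ • eglue (-(gradient f p)) 1

/-- The unit normal on `Γ₋` (pointing downward). -/
def nuM {m : ℕ} (g : E m → ℝ) (p : E m) : E (m+1) :=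
  (Real.sqrt (1 + ‖gradient g p‖^2))⁻¹ • eglue (gradient g p) (-1)

/-- The region `Ω_{R0} ∪ Γ₊ ∪ Γ₋`. -/
def regio {m : ℕ} (ε R0 : ℝ) (f g : E m → ℝ) : Set (E (m+1)) :=
  neck ε f g 0 R0 ∪ gammaP ε R0 f ∪ gammaM ε R0 g

/-- `u` is a solution of the local Robin problem with constants `U1`, `U2`:
`u` is C¹ on `Ω_{R0} ∪ Γ₊ ∪ Γ₋`, harmonic in `Ω_{R0}`, and satisfies
`u + γ ∂_ν u = U1` on `Γ₊` and `u + γ ∂_ν u = U2` on `Γ₋`. -/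
def IsLocalSol {m : ℕ} (ε R0 γ : ℝ) (f g : E m → ℝ) (u : E (m+1) → ℝ) (U1 U2 : ℝ) : Prop :=
  (∀ x ∈ regio ε R0 f g, DifferentiableAt ℝ u x) ∧
  ContinuousOn (fun x => gradient u x) (regio ε R0 f g) ∧
  ContDiffOn ℝ 2 u (neck ε f g 0 R0) ∧
  (∀ x ∈ neck ε f g 0 R0, elap u x = 0) ∧
  (∀ p ∈ ball (0 : E m) R0,
    u (eglue p (ε/2 + f p)) + γ * ⟪nuP f p, gradient u (eglue p (ε/2 + f p))⟫ = U1) ∧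
  (∀ p ∈ ball (0 : E m) R0,
    u (eglue p (-(ε/2) + g p)) + γ * ⟪nuM g p, gradient u (eglue p (-(ε/2) + g p))⟫ = U2)

/-- `f` is C^{1,1} with C^{1,1} norm at most `c`. -/
def C11 {k : ℕ} (c : ℝ) (f : E k → ℝ) : Prop :=
  Differentiable ℝ f ∧ (∀ p, |f p| ≤ c) ∧ (∀ p, ‖gradient f p‖ ≤ c) ∧
    LipschitzWith c.toNNReal (fun p => gradient f p)

/-- The standing hypotheses on `f`, `g`:  C^{1,1} norms at most `c2`,
`f(0)=g(0)=0`, `∇f(0)=∇g(0)=0`, and `c1 |x'|² ≤ f - g` on `|x'| < R0`. -/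
def FGSetting {m : ℕ} (R0 c1 c2 : ℝ) (f g : E m → ℝ) : Prop :=
  C11 c2 f ∧ C11 c2 g ∧ f 0 = 0 ∧ g 0 = 0 ∧ gradient f 0 = 0 ∧ gradient g 0 = 0 ∧
    ∀ p : E m, ‖p‖ < R0 → c1 * ‖p‖^2 ≤ f p - g p

/-- Reflection of the last coordinate: `(x', x_n) ↦ (x', -x_n)`. -/
def reflLast {m : ℕ} (x : E (m+1)) : E (m+1) := eglue (epre x) (-(lastC x))

section Auxiliary

open Filter Topology

lemma second_deriv_le_of_le_quadratic {g g1 : ℝ → ℝ} {c α β : ℝ}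
    (hg : ∀ᶠ t in 𝓝 (0:ℝ), HasDerivAt g (g1 t) t) (hg1 : HasDerivAt g1 c 0)
    (hle : ∀ᶠ t in 𝓝 (0:ℝ), g t ≤ g 0 + α * t + β * t ^ 2) : c ≤ 2 * β := by
  by_contra! hc
  set h : ℝ → ℝ := fun t => g t - α * t - β * t ^ 2 with hh
  have hd : ∀ᶠ t in 𝓝 (0:ℝ), HasDerivAt h (g1 t - α - 2 * β * t) t := by
    filter_upwards [hg] with t ht
    have := (ht.sub ((hasDerivAt_id t).const_mul α)).sub (((hasDerivAt_id t).pow 2).const_mul β)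
    refine this.congr_deriv ?_
    simp; ring
  have hmax : IsLocalMax h 0 := by
    filter_upwards [hle] with t ht
    simp only [hh]; nlinarith
  have hd1 : deriv h =ᶠ[𝓝 0] fun t => g1 t - α - 2 * β * t := hd.mono fun t ht => ht.deriv
  have hdd : HasDerivAt (deriv h) (c - 2 * β) 0 := by
    have : HasDerivAt (fun t => g1 t - α - 2 * β * t) (c - 2 * β * 1) 0 :=
      (hg1.sub_const α).sub ((hasDerivAt_id (0:ℝ)).const_mul (2 * β))
    exact (this.congr_deriv (by ring)).congr_of_eventuallyEq hd1
  have hmin : IsLocalMin h 0 :=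
    isLocalMin_of_deriv_deriv_pos (by rw [hdd.deriv]; linarith) hmax.deriv_eq_zero
      hd.self_of_nhds.continuousAt
  have hconst : h =ᶠ[𝓝 0] fun _ => h 0 := by
    filter_upwards [hmax, hmin] with t h1 h2 using le_antisymm h1 h2
  have h0 : deriv h =ᶠ[𝓝 0] fun _ => 0 := by
    have := hconst.deriv
    simpa using this
  have : HasDerivAt (deriv h) 0 0 := (hasDerivAt_const (0:ℝ) (0:ℝ)).congr_of_eventuallyEq h0
  have := hdd.unique this
  linarith

lemma deriv_le_of_le_quadratic {g : ℝ → ℝ} {c α β : ℝ} (hg : HasDerivAt g c 0)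
    (hle : ∀ᶠ t in 𝓝[>] (0:ℝ), g t ≤ g 0 + α * t + β * t ^ 2) : c ≤ α := by
  have hs : Tendsto (fun t : ℝ => t⁻¹ * (g t - g 0)) (𝓝[>] 0) (𝓝 c) := by
    have := hg.tendsto_slope_zero_right
    simpa using this
  have hr : Tendsto (fun t : ℝ => α + β * t) (𝓝[>] 0) (𝓝 α) := by
    have : Tendsto (fun t : ℝ => α + β * t) (𝓝 0) (𝓝 (α + β * 0)) :=
      (continuous_const.add (continuous_const.mul continuous_id)).tendsto 0
    simpa using this.mono_left nhdsWithin_le_nhds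
  refine le_of_tendsto_of_tendsto hs hr ?_
  filter_upwards [hle, self_mem_nhdsWithin] with t ht ht0
  have ht0 : 0 < t := ht0
  rw [inv_mul_le_iff₀ ht0]
  nlinarith

section Lines

variable {V : Type*} [NormedAddCommGroup V] [InnerProductSpace ℝ V]

lemma ContDiffAt.eventually_hasDerivAt_line {u : V → ℝ} {x : V} (hu : ContDiffAt ℝ 2 u x) (ξ : V) :
    ∀ᶠ t in 𝓝 (0:ℝ), HasDerivAt (fun t : ℝ => u (x + t • ξ)) (fderiv ℝ u (x + t • ξ) ξ) t := by
  have hc : Tendsto (fun t : ℝ => x + t • ξ) (𝓝 0) (𝓝 x) := by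
    have : Continuous (fun t : ℝ => x + t • ξ) := by fun_prop
    simpa using this.tendsto 0
  have h1 : ∀ᶠ z in 𝓝 x, ContDiffAt ℝ 2 u z := hu.eventually (by simp)
  filter_upwards [hc.eventually h1] with t ht
  have hl : HasDerivAt (fun t : ℝ => x + t • ξ) ξ t := by
    simpa using ((hasDerivAt_id t).smul_const ξ).const_add x
  exact (ht.differentiableAt (by norm_num)).hasFDerivAt.comp_hasDerivAt t hl

lemma ContDiffAt.hasDerivAt_fderiv_line {u : V → ℝ} {x : V} (hu : ContDiffAt ℝ 2 u x) (ξ : V) :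
    HasDerivAt (fun t : ℝ => fderiv ℝ u (x + t • ξ) ξ)
      (iteratedFDeriv ℝ 2 u x ![ξ, ξ]) 0 := by
  have hl : HasDerivAt (fun t : ℝ => x + t • ξ) ξ 0 := by
    simpa using ((hasDerivAt_id (0:ℝ)).smul_const ξ).const_add x
  have hf : HasFDerivAt (fderiv ℝ u) (fderiv ℝ (fderiv ℝ u) x) (x + (0:ℝ) • ξ) := by
    simpa using ((hu.fderiv_right (m := 1) (by norm_num)).differentiableAt (by norm_num)).hasFDerivAt
  have h1 := hf.comp_hasDerivAt (0:ℝ) hl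
  have h2 := (ContinuousLinearMap.apply ℝ ℝ ξ).hasFDerivAt.comp_hasDerivAt (0:ℝ) h1
  rw [iteratedFDeriv_two_apply]
  exact h2

lemma iteratedFDeriv_sub_le_of_le_quadratic {u v : V → ℝ} {x y ξ η : V} {α β : ℝ}
    (hu : ContDiffAt ℝ 2 u x) (hv : ContDiffAt ℝ 2 v y)
    (hle : ∀ᶠ t in 𝓝 (0:ℝ),
      u (x + t • ξ) - v (y + t • η) ≤ u x - v y + α * t + β * t ^ 2) :
    iteratedFDeriv ℝ 2 u x ![ξ, ξ] - iteratedFDeriv ℝ 2 v y ![η, η] ≤ 2 * β := by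
  refine second_deriv_le_of_le_quadratic (g := fun t => u (x + t • ξ) - v (y + t • η)) (α := α) ?_
    ((hu.hasDerivAt_fderiv_line ξ).sub (hv.hasDerivAt_fderiv_line η)) (by simpa using hle)
  filter_upwards [hu.eventually_hasDerivAt_line ξ, hv.eventually_hasDerivAt_line η] with t h1 h2
  exact h1.sub h2

lemma iteratedFDeriv_le_of_le_quadratic {u : V → ℝ} {x ξ : V} {α β : ℝ}
    (hu : ContDiffAt ℝ 2 u x)
    (hle : ∀ᶠ t in 𝓝 (0:ℝ), u (x + t • ξ) ≤ u x + α * t + β * t ^ 2) :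
    iteratedFDeriv ℝ 2 u x ![ξ, ξ] ≤ 2 * β := by
  refine second_deriv_le_of_le_quadratic (g := fun t => u (x + t • ξ)) (α := α)
    (hu.eventually_hasDerivAt_line ξ) (hu.hasDerivAt_fderiv_line ξ) (by simpa using hle)

/-- The localization function of the doubling argument. -/
def cusp (k z : V) : ℝ := 2 * ‖z‖ ^ 2 + ⟪z, k⟫ * ‖z‖

lemma cusp_ge {k : V} (hk : ‖k‖ = 1) (z : V) : ‖z‖ ^ 2 ≤ cusp k z := by
  have h := abs_le.1 (abs_real_inner_le_norm z k)
  rw [hk, mul_one] at h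
  unfold cusp
  nlinarith [norm_nonneg z]

lemma continuous_cusp (k : V) : Continuous (cusp k) := by
  unfold cusp; fun_prop

/-- The gradient of `cusp k`. -/
def cuspGrad (k z : V) : V := (4:ℝ) • z + ‖z‖ • k + (⟪z, k⟫ / ‖z‖) • z

lemma norm_add_sub_norm_sub_le (z w : V) (hz : z ≠ 0) :
    |‖z + w‖ - ‖z‖ - ⟪z, w⟫ / ‖z‖| ≤ 2 * ‖w‖ ^ 2 / ‖z‖ := by
  have hz' : 0 < ‖z‖ := norm_pos_iff.2 hz
  have h1 : ‖z + w‖ ^ 2 = ‖z‖ ^ 2 + 2 * ⟪z, w⟫ + ‖w‖ ^ 2 := norm_add_sq_real z w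
  have h2 : |⟪z, w⟫| ≤ ‖z‖ * ‖w‖ := abs_real_inner_le_norm z w
  have h3 : |‖z + w‖ - ‖z‖| ≤ ‖w‖ := by simpa using abs_norm_sub_norm_le (z + w) z
  set p := ‖z + w‖ with hp
  set q := ‖z‖
  set r := ⟪z, w⟫
  have hp0 : 0 ≤ p := norm_nonneg _
  have hw0 : 0 ≤ ‖w‖ := norm_nonneg _
  have e : (p - q - r / q) * (p + q) * q = ‖w‖ ^ 2 * q + r * (q - p) := by
    field_simp
    nlinarith
  have h4 : |r * (q - p)| ≤ q * ‖w‖ * ‖w‖ := by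
    rw [abs_mul, abs_sub_comm q p]
    exact mul_le_mul h2 h3 (abs_nonneg _) (by positivity)
  have h5 : |p - q - r / q| * ((p + q) * q) ≤ 2 * ‖w‖ ^ 2 * q := by
    rw [← abs_of_nonneg (show 0 ≤ (p + q) * q by positivity), ← abs_mul, ← mul_assoc, e]
    refine (abs_add_le _ _).trans ?_
    rw [abs_of_nonneg (by positivity)]
    nlinarith
  rw [le_div_iff₀ hz']
  have h6 : |p - q - r / q| * (p + q) ≤ 2 * ‖w‖ ^ 2 := by
    refine le_of_mul_le_mul_right ?_ hz'
    nlinarith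
  nlinarith [abs_nonneg (p - q - r / q)]

lemma cusp_add_le {k : V} (hk : ‖k‖ = 1) (z w : V) :
    cusp k (z + w) ≤ cusp k z + ⟪cuspGrad k z, w⟫ + 5 * ‖w‖ ^ 2 := by
  have hkw : |⟪w, k⟫| ≤ ‖w‖ := by simpa [hk] using abs_real_inner_le_norm w k
  have hkz : |⟪z, k⟫| ≤ ‖z‖ := by simpa [hk] using abs_real_inner_le_norm z k
  have h1 : ‖z + w‖ ^ 2 = ‖z‖ ^ 2 + 2 * ⟪z, w⟫ + ‖w‖ ^ 2 := norm_add_sq_real z w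
  have h3 : |‖z + w‖ - ‖z‖| ≤ ‖w‖ := by simpa using abs_norm_sub_norm_le (z + w) z
  have e1 : ⟪cuspGrad k z, w⟫ = 4 * ⟪z, w⟫ + ‖z‖ * ⟪w, k⟫ + ⟪z, k⟫ / ‖z‖ * ⟪z, w⟫ := by
    simp only [cuspGrad, inner_add_left, real_inner_smul_left, real_inner_comm k w]
  have e2 : cusp k (z + w) = 2 * ‖z + w‖ ^ 2 + ⟪z, k⟫ * ‖z + w‖ + ⟪w, k⟫ * ‖z + w‖ := by
    simp only [cusp, inner_add_left]; ring
  have h4 : ⟪w, k⟫ * (‖z + w‖ - ‖z‖) ≤ ‖w‖ * ‖w‖ := by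
    refine (le_abs_self _).trans ?_
    rw [abs_mul]
    exact mul_le_mul hkw h3 (abs_nonneg _) (norm_nonneg _)
  have h5 : ⟪z, k⟫ * (‖z + w‖ - ‖z‖) - ⟪z, k⟫ / ‖z‖ * ⟪z, w⟫ ≤ 2 * ‖w‖ ^ 2 := by
    rcases eq_or_ne z 0 with rfl | hz
    · simp
    have hz' : 0 < ‖z‖ := norm_pos_iff.2 hz
    have h6 := norm_add_sub_norm_sub_le z w hz
    calc ⟪z, k⟫ * (‖z + w‖ - ‖z‖) - ⟪z, k⟫ / ‖z‖ * ⟪z, w⟫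
        = ⟪z, k⟫ * (‖z + w‖ - ‖z‖ - ⟪z, w⟫ / ‖z‖) := by ring
      _ ≤ |⟪z, k⟫ * (‖z + w‖ - ‖z‖ - ⟪z, w⟫ / ‖z‖)| := le_abs_self _
      _ ≤ ‖z‖ * (2 * ‖w‖ ^ 2 / ‖z‖) := by
          rw [abs_mul]
          exact mul_le_mul hkz h6 (abs_nonneg _) (norm_nonneg _)
      _ = 2 * ‖w‖ ^ 2 := by field_simp
  rw [e1, e2]
  unfold cusp
  nlinarith

end Lines

lemma elap_eq_sum_basis {k : ℕ} {ι : Type*} [Fintype ι] (b : OrthonormalBasis ι ℝ (E k))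
    (u : E k → ℝ) (x : E k) : elap u x = ∑ i, iteratedFDeriv ℝ 2 u x ![b i, b i] := by
  have h1 := congrFun (InnerProductSpace.laplacian_eq_iteratedFDeriv_orthonormalBasis u b) x
  have h2 := congrFun (InnerProductSpace.laplacian_eq_iteratedFDeriv_orthonormalBasis u
    (EuclideanSpace.basisFun (Fin k) ℝ)) x
  rw [← h1, h2]
  simp [elap]

section Doubling

variable {V : Type*} [NormedAddCommGroup V] [InnerProductSpace ℝ V]

/-- The two-point modulus of the doubling argument. -/
def pairMod (ρ c : ℝ) (k x0 x y : V) : ℝ :=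
  (‖x - y‖ - ‖x - y‖ ^ 2 / (8 * ρ)) * (1 + 4 * c * ⟪(x - x0) + (y - x0), k⟫)

/-- The doubled function whose maximum is studied. -/
def doubled (ρ c L B : ℝ) (k x0 a : V) (u : V → ℝ) (x y : V) : ℝ :=
  (u x - ⟪a, x⟫) - (u y - ⟪a, y⟫) - L * pairMod ρ c k x0 x y
    - B * cusp k (x - x0) - B * cusp k (y - x0)

lemma pairMod_swap (ρ c : ℝ) (k x0 x y : V) : pairMod ρ c k x0 x y = pairMod ρ c k x0 y x := by
  unfold pairMod
  rw [norm_sub_rev, add_comm (x - x0)]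

lemma doubled_neg_swap (ρ c L B : ℝ) (k x0 a : V) (u : V → ℝ) (x y : V) :
    doubled ρ c L B k x0 (-a) (fun z => -u z) y x = doubled ρ c L B k x0 a u x y := by
  unfold doubled
  rw [pairMod_swap]
  simp only [inner_neg_left]
  ring

lemma abs_tilt_le {ρ c : ℝ} {k x0 x y : V} (hk : ‖k‖ = 1) (hc : 0 < c) (hcρ : 16 * c * ρ ≤ 1)
    (hx : ‖x - x0‖ ≤ ρ) (hy : ‖y - x0‖ ≤ ρ) :
    |4 * c * ⟪(x - x0) + (y - x0), k⟫| ≤ 1 / 2 := by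
  have h1 : |⟪(x - x0) + (y - x0), k⟫| ≤ ‖(x - x0) + (y - x0)‖ := by
    simpa [hk] using abs_real_inner_le_norm ((x - x0) + (y - x0)) k
  have h2 := norm_add_le (x - x0) (y - x0)
  rw [abs_mul, abs_of_pos (by positivity : 0 < 4 * c)]
  nlinarith

lemma pairMod_nonneg {ρ c : ℝ} {k x0 x y : V} (hk : ‖k‖ = 1) (hρ : 0 < ρ) (hc : 0 < c)
    (hcρ : 16 * c * ρ ≤ 1) (hx : ‖x - x0‖ ≤ ρ) (hy : ‖y - x0‖ ≤ ρ) :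
    0 ≤ pairMod ρ c k x0 x y := by
  have h := abs_le.1 (abs_tilt_le hk hc hcρ hx hy)
  have hs : ‖x - y‖ ≤ 2 * ρ := by
    have := norm_sub_le (x - x0) (y - x0)
    rw [sub_sub_sub_cancel_right] at this
    linarith
  refine mul_nonneg ?_ (by linarith)
  rw [sub_nonneg, div_le_iff₀ (by positivity)]
  nlinarith [norm_nonneg (x - y)]

lemma norm_sub_smul_hasDerivAt {z N : V} (hz : z ≠ 0) :
    HasDerivAt (fun t : ℝ => ‖z - t • N‖) (-(⟪z, N⟫ / ‖z‖)) 0 := by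
  have hl : HasDerivAt (fun t : ℝ => z - t • N) (-N) 0 := by
    simpa using ((hasDerivAt_id (0:ℝ)).smul_const N).const_sub z
  have h2 := hl.norm_sq.sqrt (by simpa using hz)
  refine (h2.congr_deriv ?_).congr_of_eventuallyEq (Eventually.of_forall fun t => ?_)
  · have : 0 < ‖z‖ := norm_pos_iff.2 hz
    simp [Real.sqrt_sq this.le]
    field_simp
  · simp [Real.sqrt_sq (norm_nonneg _)]

lemma pairMod_hasDerivAt {ρ c : ℝ} {k x0 x y N : V} (hxy : x ≠ y) (hN : ⟪N, k⟫ = 1) :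
    HasDerivAt (fun t : ℝ => pairMod ρ c k x0 (x - t • N) y)
      (-((⟪x - y, N⟫ / ‖x - y‖) * (1 - ‖x - y‖ / (4 * ρ)) *
          (1 + 4 * c * ⟪(x - x0) + (y - x0), k⟫) +
        (‖x - y‖ - ‖x - y‖ ^ 2 / (8 * ρ)) * (4 * c))) 0 := by
  have h1 : HasDerivAt (fun t : ℝ => ‖x - t • N - y‖) (-(⟪x - y, N⟫ / ‖x - y‖)) 0 := by
    have := norm_sub_smul_hasDerivAt (N := N) (sub_ne_zero.2 hxy)
    refine this.congr_of_eventuallyEq (Eventually.of_forall fun t => ?_)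
    simp only [sub_right_comm]
  have h2 : HasDerivAt (fun t : ℝ => 1 + 4 * c * ⟪(x - t • N - x0) + (y - x0), k⟫)
      (-(4 * c)) 0 := by
    have : (fun t : ℝ => 1 + 4 * c * ⟪(x - t • N - x0) + (y - x0), k⟫) =
        fun t : ℝ => 1 + 4 * c * ⟪(x - x0) + (y - x0), k⟫ - 4 * c * t := by
      funext t
      rw [show (x - t • N - x0) + (y - x0) = (x - x0) + (y - x0) - t • N by abel,
        inner_sub_left, real_inner_smul_left, hN]
      ring
    rw [this]
    simpa using ((hasDerivAt_id (0:ℝ)).const_mul (4 * c)).const_sub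
      (1 + 4 * c * ⟪(x - x0) + (y - x0), k⟫)
  refine ((h1.sub ((h1.pow 2).div_const (8 * ρ))).mul h2).congr_deriv ?_
  simp
  ring

set_option maxHeartbeats 1000000 in
/-- First-order obstruction to a maximum of the doubled function at a boundary point. -/
lemma boundary_not_max {ρ c L B Er : ℝ} {k x0 a x y N : V} {u : V → ℝ} {D : Set V} {d : ℝ}
    (hk : ‖k‖ = 1) (hρ : 0 < ρ) (hc : 0 < c) (hcρ : 16 * c * ρ ≤ 1) (hL : 0 < L) (hB : 0 < B)
    (hBE : 4 * Er ≤ B)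
    (hx : ‖x - x0‖ < ρ) (hy : ‖y - x0‖ ≤ ρ) (hxy : x ≠ y) (hx0D : x0 ∈ D) (hyD : y ∈ D)
    (hN : ⟪N, k⟫ = 1) (hND : ∀ z ∈ D, -c * ‖x - z‖ ^ 2 ≤ ⟪x - z, N⟫)
    (hin : ∀ᶠ t in 𝓝[>] (0:ℝ), x - t • N ∈ D)
    (hd : HasDerivAt (fun t : ℝ => u (x - t • N)) (-d) 0)
    (hdE : d - ⟪a, N⟫ ≤ Er * ‖x - x0‖)
    (hmax : ∀ z ∈ D, ‖z - x0‖ ≤ ρ →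
      doubled ρ c L B k x0 a u z y ≤ doubled ρ c L B k x0 a u x y) : False := by
  set s := ‖x - y‖ with hs
  have hs0 : 0 < s := norm_pos_iff.2 (sub_ne_zero.2 hxy)
  have hs2 : s ≤ 2 * ρ := by
    have := norm_sub_le (x - x0) (y - x0)
    rw [sub_sub_sub_cancel_right] at this
    linarith
  set θ := 1 + 4 * c * ⟪(x - x0) + (y - x0), k⟫ with hθ
  have hθ' := abs_le.1 (abs_tilt_le hk hc hcρ hx.le hy)
  have hθ1 : 1 / 2 ≤ θ := by linarith
  have hθ2 : θ ≤ 3 / 2 := by linarith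
  have hnear : ∀ᶠ t in 𝓝[>] (0:ℝ), ‖x - t • N - x0‖ < ρ := by
    have hcont : Continuous fun t : ℝ => ‖x - t • N - x0‖ := by fun_prop
    have := hcont.tendsto 0
    simp only [zero_smul, sub_zero] at this
    exact (this.eventually (gt_mem_nhds hx)).filter_mono nhdsWithin_le_nhds
  have hder : HasDerivAt (fun t : ℝ => (u (x - t • N) - ⟪a, x - t • N⟫)
      - L * pairMod ρ c k x0 (x - t • N) y)
      ((-d + ⟪a, N⟫) - L * (-((⟪x - y, N⟫ / s) * (1 - s / (4 * ρ)) * θ +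
        (s - s ^ 2 / (8 * ρ)) * (4 * c)))) 0 := by
    have ha : HasDerivAt (fun t : ℝ => ⟪a, x - t • N⟫) (-⟪a, N⟫) 0 := by
      have : (fun t : ℝ => ⟪a, x - t • N⟫) = fun t : ℝ => ⟪a, x⟫ - t * ⟪a, N⟫ := by
        funext t; rw [inner_sub_right, real_inner_smul_right]
      rw [this]
      simpa using ((hasDerivAt_id (0:ℝ)).mul_const ⟪a, N⟫).const_sub ⟪a, x⟫
    refine ((hd.sub ha).sub ((pairMod_hasDerivAt hxy hN).const_mul L)).congr_deriv ?_
    rw [← hs, ← hθ]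
    ring
  have key := deriv_le_of_le_quadratic (α := -(B * ⟪cuspGrad k (x - x0), N⟫))
    (β := B * (5 * ‖N‖ ^ 2)) hder (by
      filter_upwards [hin, hnear] with t ht1 ht2
      have h1 := hmax _ ht1 ht2.le
      have h2 := cusp_add_le hk (x - x0) (-(t • N))
      rw [show x - x0 + -(t • N) = x - t • N - x0 by abel, inner_neg_right, real_inner_smul_right,
        norm_neg, norm_smul, mul_pow, Real.norm_eq_abs, sq_abs] at h2
      have h3 := mul_le_mul_of_nonneg_left h2 hB.le
      simp only [zero_smul, sub_zero]
      unfold doubled at h1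
      nlinarith)
  -- lower bound for the normal derivative of the test function
  have hI1 : -(3 / 2 * c * s) ≤ (⟪x - y, N⟫ / s) * (1 - s / (4 * ρ)) * θ := by
    have h1 : -(c * s) ≤ ⟪x - y, N⟫ / s := by
      rw [le_div_iff₀ hs0]
      have := hND y hyD
      rw [← hs] at this
      nlinarith
    have h2 : 0 ≤ 1 - s / (4 * ρ) := by
      rw [sub_nonneg, div_le_one (by positivity)]; linarith
    have h3 : 1 - s / (4 * ρ) ≤ 1 := by
      have : 0 ≤ s / (4 * ρ) := by positivity
      linarith
    have h4 : (1 - s / (4 * ρ)) * θ ≤ 3 / 2 := by nlinarith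
    have h5 : 0 ≤ (1 - s / (4 * ρ)) * θ := mul_nonneg h2 (by linarith)
    rw [mul_assoc]
    have hcs : 0 < c * s := by positivity
    nlinarith
  have hI2 : 3 * c * s ≤ (s - s ^ 2 / (8 * ρ)) * (4 * c) := by
    have : s ^ 2 / (8 * ρ) ≤ s / 4 := by
      rw [div_le_iff₀ (by positivity)]; nlinarith
    nlinarith
  have hP : ‖x - x0‖ / 4 ≤ ⟪cuspGrad k (x - x0), N⟫ := by
    set z := x - x0
    have e1 : ⟪cuspGrad k z, N⟫ = (4 + ⟪z, k⟫ / ‖z‖) * ⟪z, N⟫ + ‖z‖ := by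
      simp only [cuspGrad, inner_add_left, real_inner_smul_left, real_inner_comm N k, hN]
      ring
    have h1 := hND x0 hx0D
    have hz0 := norm_nonneg z
    have h2 : |⟪z, k⟫ / ‖z‖| ≤ 1 := by
      rw [abs_div, abs_of_nonneg hz0]
      refine div_le_one_of_le₀ ?_ hz0
      simpa [hk] using abs_real_inner_le_norm z k
    have h3 := abs_le.1 h2
    have h4 : -(5 * (c * ‖z‖ ^ 2)) ≤ (4 + ⟪z, k⟫ / ‖z‖) * ⟪z, N⟫ := by
      have : 0 ≤ c * ‖z‖ ^ 2 := by positivity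
      nlinarith
    have h5 : c * ‖z‖ ^ 2 ≤ ‖z‖ / 16 := by nlinarith [mul_nonneg hz0 hc.le]
    rw [e1]
    linarith
  have hcs : 0 < c * s := by positivity
  have hfin : 0 < L * ((⟪x - y, N⟫ / s) * (1 - s / (4 * ρ)) * θ +
        (s - s ^ 2 / (8 * ρ)) * (4 * c)) := mul_pos hL (by linarith)
  have hB2 : B * (‖x - x0‖ / 4) ≤ B * ⟪cuspGrad k (x - x0), N⟫ :=
    mul_le_mul_of_nonneg_left hP hB.le
  nlinarith [norm_nonneg (x - x0)]

/-- Second-order obstruction to a maximum of the doubled function at a pair of interior points. -/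
lemma interior_not_max {n : ℕ} {ρ c L B : ℝ} {k x0 a x y : E n} {u : E n → ℝ}
    (hk : ‖k‖ = 1) (hρ : 0 < ρ) (hc : 0 < c) (hcρ : 16 * c * ρ ≤ 1) (hB : 0 < B)
    (hL : 40 * n * B * ρ < L)
    (hx : ‖x - x0‖ < ρ) (hy : ‖y - x0‖ < ρ) (hxy : x ≠ y)
    (hux : ContDiffAt ℝ 2 u x) (huy : ContDiffAt ℝ 2 u y)
    (hΔx : elap u x = 0) (hΔy : elap u y = 0)
    (hmax : ∀ᶠ p in 𝓝 (x, y),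
      doubled ρ c L B k x0 a u p.1 p.2 ≤ doubled ρ c L B k x0 a u x y) : False := by
  have hL0 : 0 < L := lt_of_le_of_lt (by positivity) hL
  set s := ‖x - y‖ with hs
  have hs0 : 0 < s := norm_pos_iff.2 (sub_ne_zero.2 hxy)
  set θ := 1 + 4 * c * ⟪(x - x0) + (y - x0), k⟫ with hθ
  have hθ' := abs_le.1 (abs_tilt_le hk hc hcρ hx.le hy.le)
  have hθ1 : 1 / 2 ≤ θ := by linarith
  set e : E n := s⁻¹ • (x - y) with he
  have hen : ‖e‖ = 1 := by
    rw [he, norm_smul, norm_inv, Real.norm_of_nonneg hs0.le, ← hs]; field_simp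
  have hse : x - y = s • e := by rw [he, smul_smul, mul_inv_cancel₀ hs0.ne', one_smul]
  obtain ⟨v, b, hv, hb⟩ := ((orthonormal_subtype_iff_ite (𝕜 := ℝ) (s := ({e} : Set (E n)))).2 (by
    intro w hw z hz
    rw [Set.mem_singleton_iff] at hw hz
    subst hw; subst hz
    simp [hen])).exists_orthonormalBasis_extension
  have hline : ∀ ξ η : E n, ∀ᶠ t in 𝓝 (0:ℝ),
      doubled ρ c L B k x0 a u (x + t • ξ) (y + t • η) ≤ doubled ρ c L B k x0 a u x y := by
    intro ξ η
    have hcont : Continuous fun t : ℝ => (x + t • ξ, y + t • η) := by fun_prop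
    have := hcont.tendsto 0
    simp only [zero_smul, add_zero] at this
    exact this.eventually hmax
  have hgen : ∀ (ξ η : E n) (σ μ : ℝ), ‖ξ‖ = 1 → ‖η‖ = 1 →
      (∀ᶠ t in 𝓝 (0:ℝ), L * pairMod ρ c k x0 (x + t • ξ) (y + t • η) ≤
        L * pairMod ρ c k x0 x y + σ * t + μ * t ^ 2) →
      iteratedFDeriv ℝ 2 u x ![ξ, ξ] - iteratedFDeriv ℝ 2 u y ![η, η] ≤ 2 * (10 * B + μ) := by
    intro ξ η σ μ hξ hη hm
    refine iteratedFDeriv_sub_le_of_le_quadratic (α := ⟪a, ξ⟫ - ⟪a, η⟫ + σ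
      + B * ⟪cuspGrad k (x - x0), ξ⟫ + B * ⟪cuspGrad k (y - x0), η⟫) hux huy ?_
    filter_upwards [hline ξ η, hm] with t h1 h2
    have h3 := mul_le_mul_of_nonneg_left (cusp_add_le hk (x - x0) (t • ξ)) hB.le
    have h4 := mul_le_mul_of_nonneg_left (cusp_add_le hk (y - x0) (t • η)) hB.le
    rw [show x - x0 + t • ξ = x + t • ξ - x0 by abel, real_inner_smul_right,
      norm_smul, mul_pow, Real.norm_eq_abs, sq_abs, hξ] at h3
    rw [show y - x0 + t • η = y + t • η - x0 by abel, real_inner_smul_right,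
      norm_smul, mul_pow, Real.norm_eq_abs, sq_abs, hη] at h4
    unfold doubled at h1
    simp only [inner_add_right, real_inner_smul_right] at h1
    linarith
  have hperp : ∀ i : v,
      iteratedFDeriv ℝ 2 u x ![b i, b i] - iteratedFDeriv ℝ 2 u y ![b i, b i] ≤ 20 * B := by
    intro i
    have h := hgen (b i) (b i) (L * ((s - s ^ 2 / (8 * ρ)) * (4 * c * ⟪(2:ℝ) • b i, k⟫))) 0
      (b.orthonormal.1 i) (b.orthonormal.1 i) (Eventually.of_forall fun t => le_of_eq (by
        unfold pairMod
        rw [show x + t • b i - (y + t • b i) = x - y by abel,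
          show (x + t • b i - x0) + (y + t • b i - x0)
            = ((x - x0) + (y - x0)) + t • ((2:ℝ) • b i) by module,
          inner_add_left, real_inner_smul_left _ _ t, ← hs]
        ring))
    linarith
  have hev : e ∈ v := hv rfl
  have hpar : iteratedFDeriv ℝ 2 u x ![e, e] - iteratedFDeriv ℝ 2 u y ![-e, -e]
      ≤ 20 * B - L / (2 * ρ) := by
    have h := hgen e (-e) (L * ((2 - s / (2 * ρ)) * θ)) (-(L / (2 * ρ) * θ)) hen
      (by rw [norm_neg, hen]) (by
        filter_upwards [lt_mem_nhds (show -(s / 2) < 0 by linarith)] with t ht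
        refine le_of_eq ?_
        unfold pairMod
        rw [show x + t • e - (y + t • -e) = (s + 2 * t) • e by
            rw [add_smul, ← hse]; module,
          show (x + t • e - x0) + (y + t • -e - x0) = (x - x0) + (y - x0) by module,
          norm_smul, hen, mul_one, Real.norm_of_nonneg (by linarith), ← hs, ← hθ]
        field_simp
        ring)
    have h2 : L / (2 * ρ) * (1 / 2) ≤ L / (2 * ρ) * θ :=
      mul_le_mul_of_nonneg_left hθ1 (by positivity)
    linarith
  have hneg : iteratedFDeriv ℝ 2 u y ![-e, -e] = iteratedFDeriv ℝ 2 u y ![e, e] := by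
    simp [iteratedFDeriv_two_apply]
  have hsum : ∑ i, (iteratedFDeriv ℝ 2 u x ![b i, b i] - iteratedFDeriv ℝ 2 u y ![b i, b i]) = 0 := by
    rw [Finset.sum_sub_distrib, ← elap_eq_sum_basis b, ← elap_eq_sum_basis b, hΔx, hΔy, sub_zero]
  have hcard : (Finset.univ : Finset v).card = n := by
    have := Module.finrank_eq_card_basis b.toBasis
    simpa using this.symm
  have hle : ∑ i, (iteratedFDeriv ℝ 2 u x ![b i, b i] - iteratedFDeriv ℝ 2 u y ![b i, b i])
      ≤ ∑ i : v, (20 * B + if i = ⟨e, hev⟩ then -(L / (2 * ρ)) else 0) := by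
    refine Finset.sum_le_sum fun i _ => ?_
    split_ifs with hi
    · subst hi
      rw [hb]
      rw [hneg] at hpar
      simpa [sub_eq_add_neg] using hpar
    · simpa using hperp i
  rw [hsum, Finset.sum_add_distrib, Finset.sum_const, hcard, Finset.sum_ite_eq' Finset.univ,
    if_pos (Finset.mem_univ _), nsmul_eq_mul] at hle
  have : L / (2 * ρ) ≤ n * (20 * B) := by linarith
  rw [div_le_iff₀ (by positivity)] at this
  nlinarith

end Doubling

/-- At `x` the function `u` is either harmonic in the interior of `D`, or `x` is a boundary point
of `D` with (unnormalized) normal `N` at which the normal derivative of `u - ⟪a, ·⟫` is at most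
`Er * ‖x - x0‖` in absolute value. -/
def NeumannPoint {n : ℕ} (c Er : ℝ) (k x0 a : E n) (u : E n → ℝ) (D : Set (E n)) (x : E n) : Prop :=
  (D ∈ 𝓝 x ∧ ContDiffAt ℝ 2 u x ∧ elap u x = 0) ∨
  ∃ (N : E n) (d : ℝ), ⟪N, k⟫ = 1 ∧ (∀ z ∈ D, -c * ‖x - z‖ ^ 2 ≤ ⟪x - z, N⟫) ∧
    (∀ᶠ t in 𝓝[>] (0:ℝ), x - t • N ∈ D) ∧
    HasDerivAt (fun t : ℝ => u (x - t • N)) (-d) 0 ∧ |d - ⟪a, N⟫| ≤ Er * ‖x - x0‖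

lemma doubled_nonpos {n : ℕ} {ρ c L B Er W : ℝ} {k x0 a : E n} {u : E n → ℝ} {D : Set (E n)}
    (hk : ‖k‖ = 1) (hρ : 0 < ρ) (hc : 0 < c) (hcρ : 16 * c * ρ ≤ 1) (hB : 0 < B)
    (hL : 40 * n * B * ρ < L) (hBE : 4 * Er ≤ B) (hBW : 2 * W ≤ B * ρ ^ 2)
    (hD : IsClosed D) (hx0 : x0 ∈ D) (hu : ContinuousOn u (D ∩ closedBall x0 ρ))
    (hW : ∀ x ∈ D ∩ closedBall x0 ρ, |u x - ⟪a, x - x0⟫| ≤ W)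
    (hpt : ∀ x ∈ D, ‖x - x0‖ < ρ → NeumannPoint c Er k x0 a u D x) :
    ∀ x ∈ D ∩ closedBall x0 ρ, ∀ y ∈ D ∩ closedBall x0 ρ, doubled ρ c L B k x0 a u x y ≤ 0 := by
  have hL0 : 0 < L := lt_of_le_of_lt (by positivity) hL
  set S := D ∩ closedBall x0 ρ with hS
  have hSc : IsCompact S := (isCompact_closedBall x0 ρ).inter_left hD
  have hcont : ContinuousOn (fun p : E n × E n => doubled ρ c L B k x0 a u p.1 p.2) (S ×ˢ S) := by
    have h1 : ContinuousOn (fun p : E n × E n => u p.1) (S ×ˢ S) :=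
      hu.comp continuousOn_fst fun p hp => hp.1
    have h2 : ContinuousOn (fun p : E n × E n => u p.2) (S ×ˢ S) :=
      hu.comp continuousOn_snd fun p hp => hp.2
    have h3 : Continuous (fun p : E n × E n => pairMod ρ c k x0 p.1 p.2) := by
      unfold pairMod; fun_prop
    have h4 : Continuous (fun p : E n × E n => cusp k (p.1 - x0)) :=
      (continuous_cusp k).comp (by fun_prop)
    have h5 : Continuous (fun p : E n × E n => cusp k (p.2 - x0)) :=
      (continuous_cusp k).comp (by fun_prop)
    unfold doubled
    refine ((((h1.sub ?_).sub (h2.sub ?_)).sub ?_).sub ?_).sub ?_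
    all_goals refine Continuous.continuousOn ?_
    all_goals fun_prop
  have hx0S : x0 ∈ S := ⟨hx0, mem_closedBall_self hρ.le⟩
  obtain ⟨⟨x, y⟩, ⟨hxS, hyS⟩, hmax⟩ :=
    (hSc.prod hSc).exists_isMaxOn ⟨(x0, x0), hx0S, hx0S⟩ hcont
  have hmax' : ∀ z ∈ S, ∀ w ∈ S, doubled ρ c L B k x0 a u z w ≤ doubled ρ c L B k x0 a u x y :=
    fun z hz w hw => hmax (a := (z, w)) ⟨hz, hw⟩
  suffices h : doubled ρ c L B k x0 a u x y ≤ 0 from fun z hz w hw => (hmax' z hz w hw).trans h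
  by_contra! hpos
  have hxρ : ‖x - x0‖ ≤ ρ := by simpa [dist_eq_norm] using hxS.2
  have hyρ : ‖y - x0‖ ≤ ρ := by simpa [dist_eq_norm] using hyS.2
  have hmem : ∀ z ∈ D, ‖z - x0‖ ≤ ρ → z ∈ S := fun z hz h => ⟨hz, by simpa [dist_eq_norm] using h⟩
  have hcx := mul_le_mul_of_nonneg_left (cusp_ge hk (x - x0)) hB.le
  have hcy := mul_le_mul_of_nonneg_left (cusp_ge hk (y - x0)) hB.le
  have hm := mul_nonneg hL0.le (pairMod_nonneg hk hρ hc hcρ hxρ hyρ)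
  have hcx0 : 0 ≤ B * ‖x - x0‖ ^ 2 := by positivity
  have hcy0 : 0 ≤ B * ‖y - x0‖ ^ 2 := by positivity
  have hosc : (u x - ⟪a, x⟫) - (u y - ⟪a, y⟫) ≤ 2 * W := by
    have h1 := abs_le.1 (hW x hxS)
    have h2 := abs_le.1 (hW y hyS)
    simp only [inner_sub_right] at h1 h2
    linarith
  have hdbl : doubled ρ c L B k x0 a u x y ≤ 2 * W - B * ‖x - x0‖ ^ 2 - B * ‖y - x0‖ ^ 2 := by
    unfold doubled; linarith
  have hxlt : ‖x - x0‖ < ρ := by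
    refine lt_of_le_of_ne hxρ fun h => ?_
    rw [h] at hdbl
    linarith
  have hylt : ‖y - x0‖ < ρ := by
    refine lt_of_le_of_ne hyρ fun h => ?_
    rw [h] at hdbl
    linarith
  have hxy : x ≠ y := by
    rintro rfl
    unfold doubled at hpos
    linarith
  rcases hpt x hxS.1 hxlt with ⟨hDx, hux, hΔx⟩ | ⟨N, d, hN, hND, hin, hd, hdE⟩
  · rcases hpt y hyS.1 hylt with ⟨hDy, huy, hΔy⟩ | ⟨N, d, hN, hND, hin, hd, hdE⟩
    · refine interior_not_max (a := a) hk hρ hc hcρ hB hL hxlt hylt hxy hux huy hΔx hΔy ?_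
      have hnear : ∀ z : E n, D ∈ 𝓝 z → ‖z - x0‖ < ρ → S ∈ 𝓝 z := fun z hz h =>
        inter_mem hz (Filter.mem_of_superset
          (isOpen_ball.mem_nhds (by simpa [dist_eq_norm] using h)) ball_subset_closedBall)
      filter_upwards [prod_mem_nhds (hnear x hDx hxlt) (hnear y hDy hylt)] with p hp
      exact hmax' _ hp.1 _ hp.2
    · refine boundary_not_max (a := -a) (u := fun z => -u z) (d := -d) hk hρ hc hcρ hL0 hB hBE
        hylt hxρ hxy.symm hx0 hxS.1 hN hND hin hd.neg ?_ fun z hz hzρ => ?_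
      · rw [inner_neg_left]
        linarith [(abs_le.1 hdE).1]
      · rw [doubled_neg_swap, doubled_neg_swap]
        exact hmax' _ hxS _ (hmem z hz hzρ)
  · exact boundary_not_max hk hρ hc hcρ hL0 hB hBE hxlt hyρ hxy hx0 hyS.1 hN hND hin hd
      (abs_le.1 hdE).2 fun z hz hzρ => hmax' _ (hmem z hz hzρ) _ hyS

lemma norm_gradient_le_of_neumannPoint {n : ℕ} {ρ c Er W : ℝ} {k x0 a : E n} {u : E n → ℝ}
    {D : Set (E n)} (hk : ‖k‖ = 1) (hρ : 0 < ρ) (hc : 0 < c) (hcρ : 16 * c * ρ ≤ 1) (hEr : 0 < Er)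
    (hD : IsClosed D) (hx0 : D ∈ 𝓝 x0) (hu : ContinuousOn u (D ∩ closedBall x0 ρ))
    (hux0 : DifferentiableAt ℝ u x0)
    (hW : ∀ x ∈ D ∩ closedBall x0 ρ, |u x - ⟪a, x - x0⟫| ≤ W)
    (hpt : ∀ x ∈ D, ‖x - x0‖ < ρ → NeumannPoint c Er k x0 a u D x) :
    ‖gradient u x0‖ ≤ 40 * n * (4 * Er * ρ + 2 * W / ρ) + ‖a‖ := by
  have hx0D : x0 ∈ D := mem_of_mem_nhds hx0
  have hW0 : 0 ≤ W := (abs_nonneg _).trans (hW x0 ⟨hx0D, mem_closedBall_self hρ.le⟩)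
  set B := 4 * Er + 2 * W / ρ ^ 2 with hBdef
  have hB : 0 < B := by positivity
  have hBW : 2 * W ≤ B * ρ ^ 2 := by
    have : B * ρ ^ 2 = 4 * Er * ρ ^ 2 + 2 * W := by rw [hBdef]; field_simp
    rw [this]
    have : 0 ≤ 4 * Er * ρ ^ 2 := by positivity
    linarith
  have hBE : 4 * Er ≤ B := by
    have : 0 ≤ 2 * W / ρ ^ 2 := by positivity
    linarith
  have heq : 40 * n * (4 * Er * ρ + 2 * W / ρ) = 40 * n * B * ρ := by
    rw [hBdef]; field_simp
  rw [heq]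
  rcases eq_or_ne (gradient u x0) 0 with h0 | h0
  · rw [h0, norm_zero]; positivity
  refine le_of_forall_gt_imp_ge_of_dense fun L' hL' => ?_
  obtain ⟨L, rfl⟩ : ∃ L, L' = L + ‖a‖ := ⟨L' - ‖a‖, by ring⟩
  have hL : 40 * n * B * ρ < L := by linarith
  have hL0 : 0 < L := lt_of_le_of_lt (by positivity) hL
  have key := doubled_nonpos hk hρ hc hcρ hB hL hBE hBW hD hx0D hu hW hpt
  set v : E n := ‖gradient u x0‖⁻¹ • gradient u x0 with hv
  have hg0 : 0 < ‖gradient u x0‖ := norm_pos_iff.2 h0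
  have hvn : ‖v‖ = 1 := by
    rw [hv, norm_smul, norm_inv, norm_norm]; field_simp
  have hgv : ⟪gradient u x0, v⟫ = ‖gradient u x0‖ := by
    rw [hv, real_inner_smul_right, real_inner_self_eq_norm_sq]; field_simp
  have hl : HasDerivAt (fun t : ℝ => x0 + t • v) v 0 := by
    simpa using ((hasDerivAt_id (0:ℝ)).smul_const v).const_add x0
  have hder : HasDerivAt (fun t : ℝ => u (x0 + t • v)) ‖gradient u x0‖ 0 := by
    have h1 : HasFDerivAt u (fderiv ℝ u x0) (x0 + (0:ℝ) • v) := by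
      simpa using hux0.hasFDerivAt
    refine (h1.comp_hasDerivAt (0:ℝ) hl).congr_deriv ?_
    rw [← hgv, gradient, InnerProductSpace.toDual_symm_apply]
  refine (deriv_le_of_le_quadratic (α := ⟪a, v⟫ + L) (β := L * (4 * c) + B * 5) hder ?_).trans ?_
  · have hin : ∀ᶠ t in 𝓝 (0:ℝ), x0 + t • v ∈ D := by
      have := hl.continuousAt.tendsto
      simp only [zero_smul, add_zero] at this
      exact this.eventually hx0
    filter_upwards [hin.filter_mono nhdsWithin_le_nhds, self_mem_nhdsWithin,
      (gt_mem_nhds hρ).filter_mono nhdsWithin_le_nhds] with t ht ht0 htρ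
    have ht0 : 0 < t := ht0
    have htn : ‖t • v‖ = t := by rw [norm_smul, hvn, mul_one, Real.norm_of_nonneg ht0.le]
    have h1 := key (x0 + t • v) ⟨ht, by simp [htn, htρ.le]⟩ x0 ⟨hx0D, mem_closedBall_self hρ.le⟩
    have h2 := cusp_add_le hk 0 (t • v)
    have hkv : |⟪v, k⟫| ≤ 1 := by simpa [hk, hvn] using abs_real_inner_le_norm v k
    have h3 : pairMod ρ c k x0 (x0 + t • v) x0 ≤ t + 4 * c * t ^ 2 := by
      unfold pairMod
      rw [add_sub_cancel_left, sub_self, add_zero, htn, real_inner_smul_left]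
      have h4 := abs_le.1 hkv
      have h5 : 0 ≤ t ^ 2 / (8 * ρ) := by positivity
      have h6 : 0 < c * t := by positivity
      have h7 : c * t ≤ 1 / 16 := by nlinarith
      have h8 : 0 ≤ 1 + 4 * c * (t * ⟪v, k⟫) := by nlinarith
      have h9 : 1 + 4 * c * (t * ⟪v, k⟫) ≤ 1 + 4 * c * t := by nlinarith
      calc (t - t ^ 2 / (8 * ρ)) * (1 + 4 * c * (t * ⟪v, k⟫))
          ≤ t * (1 + 4 * c * (t * ⟪v, k⟫)) := by nlinarith
        _ ≤ t * (1 + 4 * c * t) := by nlinarith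
        _ = _ := by ring
    have h10 := mul_le_mul_of_nonneg_left h3 hL0.le
    have h0c : cusp k (0 : E n) = 0 := by simp [cusp]
    have h0g : cuspGrad k (0 : E n) = 0 := by simp [cuspGrad]
    rw [h0c, h0g, inner_zero_left, zero_add, zero_add, zero_add, htn] at h2
    have h11 := mul_le_mul_of_nonneg_left h2 hB.le
    unfold doubled at h1
    rw [add_sub_cancel_left, sub_self, h0c, inner_add_right, real_inner_smul_right] at h1
    simp only [zero_smul, add_zero]
    linarith
  · have : ⟪a, v⟫ ≤ ‖a‖ := by simpa [hvn] using real_inner_le_norm a v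
    linarith

section Coordinates

variable {m : ℕ}

@[simp] lemma epre_apply (x : E (m+1)) (i : Fin m) : epre x i = x i.castSucc := rfl

@[simp] lemma eglue_castSucc (p : E m) (t : ℝ) (i : Fin m) : eglue p t i.castSucc = p i := by
  simp [eglue, EuclideanSpace.equiv]

@[simp] lemma eglue_last (p : E m) (t : ℝ) : eglue p t (Fin.last m) = t := by
  simp [eglue, EuclideanSpace.equiv]

@[simp] lemma epre_eglue (p : E m) (t : ℝ) : epre (eglue p t) = p := by
  ext i; simp

@[simp] lemma lastC_eglue (p : E m) (t : ℝ) : lastC (eglue p t) = t := eglue_last p t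

@[simp] lemma eglue_epre_lastC (x : E (m+1)) : eglue (epre x) (lastC x) = x := by
  ext i
  refine Fin.lastCases ?_ (fun j => ?_) i <;> simp [lastC]

@[simp] lemma epre_add (x y : E (m+1)) : epre (x + y) = epre x + epre y := rfl
@[simp] lemma epre_sub (x y : E (m+1)) : epre (x - y) = epre x - epre y := rfl
@[simp] lemma epre_smul (t : ℝ) (x : E (m+1)) : epre (t • x) = t • epre x := rfl
@[simp] lemma lastC_add (x y : E (m+1)) : lastC (x + y) = lastC x + lastC y := rfl
@[simp] lemma lastC_sub (x y : E (m+1)) : lastC (x - y) = lastC x - lastC y := rfl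
@[simp] lemma lastC_smul (t : ℝ) (x : E (m+1)) : lastC (t • x) = t * lastC x := rfl

lemma inner_eq_epre_lastC (x y : E (m+1)) :
    ⟪x, y⟫ = ⟪epre x, epre y⟫ + lastC x * lastC y := by
  simp only [PiLp.inner_apply, Fin.sum_univ_castSucc, epre_apply, lastC]
  simp [mul_comm]

lemma norm_sq_eq_epre_lastC (x : E (m+1)) : ‖x‖ ^ 2 = ‖epre x‖ ^ 2 + lastC x ^ 2 := by
  rw [← real_inner_self_eq_norm_sq, inner_eq_epre_lastC, real_inner_self_eq_norm_sq]
  ring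

lemma norm_epre_le (x : E (m+1)) : ‖epre x‖ ≤ ‖x‖ := by
  refine le_of_sq_le_sq ?_ (norm_nonneg x)
  nlinarith [norm_sq_eq_epre_lastC x, sq_nonneg (lastC x)]

lemma abs_lastC_le (x : E (m+1)) : |lastC x| ≤ ‖x‖ := by
  refine abs_le_of_sq_le_sq ?_ (norm_nonneg x)
  nlinarith [norm_sq_eq_epre_lastC x, sq_nonneg ‖epre x‖]

lemma continuous_lastC : Continuous (lastC : E (m+1) → ℝ) := by
  unfold lastC; fun_prop

lemma continuous_epre : Continuous (epre : E (m+1) → E m) := by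
  unfold epre; fun_prop

/-- The vertical unit vector. -/
def vert (m : ℕ) : E (m+1) := eglue 0 1

lemma inner_vert (x : E (m+1)) : ⟪x, vert m⟫ = lastC x := by
  rw [inner_eq_epre_lastC]; simp [vert]

lemma norm_vert : ‖vert m‖ = 1 := by
  have h := norm_sq_eq_epre_lastC (vert m)
  simp only [vert, epre_eglue, lastC_eglue, norm_zero] at h
  have h0 := norm_nonneg (vert m)
  simp only [vert] at h0 ⊢
  nlinarith

lemma eglue_line (p v : E m) (t s : ℝ) :
    eglue (p + t • v) s = eglue p 0 + t • eglue v 0 + s • vert m := by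
  ext i
  refine Fin.lastCases ?_ (fun j => ?_) i <;> simp [vert]

/-- The unnormalized upward normal on the graph of `f`. -/
def upN (f : E m → ℝ) (p : E m) : E (m+1) := eglue (-(gradient f p)) 1

@[simp] lemma epre_upN (f : E m → ℝ) (p : E m) : epre (upN f p) = -(gradient f p) := epre_eglue _ _
@[simp] lemma lastC_upN (f : E m → ℝ) (p : E m) : lastC (upN f p) = 1 := lastC_eglue _ _

end Coordinates

section Graph

variable {m : ℕ} {c : ℝ} {f : E m → ℝ}

lemma inner_gradient_eq (p v : E m) : ⟪gradient f p, v⟫ = fderiv ℝ f p v := by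
  rw [gradient, InnerProductSpace.toDual_symm_apply]

lemma C11.abs_sub_le (hf : C11 c f) (p q : E m) : |f q - f p| ≤ c * ‖q - p‖ := by
  have := Convex.norm_image_sub_le_of_norm_fderiv_le (𝕜 := ℝ) (f := f) (s := univ) (C := c)
    (fun x _ => hf.1 x) (fun x _ => by simpa [gradient] using hf.2.2.1 x) convex_univ
    (mem_univ p) (mem_univ q)
  simpa using this

lemma C11.norm_gradient_sub_le (hc : 0 < c) (hf : C11 c f) (p q : E m) :
    ‖gradient f p - gradient f q‖ ≤ c * ‖p - q‖ := by
  have := hf.2.2.2.norm_sub_le p q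
  rwa [Real.coe_toNNReal c hc.le] at this

lemma C11.abs_sub_inner_le (hc : 0 < c) (hf : C11 c f) (p q : E m) :
    |f q - f p - ⟪gradient f p, q - p⟫| ≤ c * ‖q - p‖ ^ 2 := by
  have := Convex.norm_image_sub_le_of_norm_fderiv_le' (𝕜 := ℝ) (f := f) (s := segment ℝ p q)
    (C := c * ‖q - p‖) (φ := fderiv ℝ f p) (fun x _ => hf.1 x) (fun x hx => ?_)
    (convex_segment p q) (left_mem_segment ℝ p q) (right_mem_segment ℝ p q)
  · rw [inner_gradient_eq]
    rw [Real.norm_eq_abs] at this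
    linarith [this]
  · have h1 := hf.norm_gradient_sub_le hc x p
    have h2 : ‖gradient f x - gradient f p‖ = ‖fderiv ℝ f x - fderiv ℝ f p‖ := by
      simp only [gradient, ← map_sub, LinearIsometryEquiv.norm_map]
    rw [← h2]
    refine h1.trans (mul_le_mul_of_nonneg_left ?_ hc.le)
    exact norm_sub_le_of_mem_segment hx

lemma C11.continuous (hf : C11 c f) : Continuous f := hf.1.continuous

/-- Points just below the graph along the normal stay below the graph. -/
lemma C11.eventually_below (hc : 0 < c) (hf : C11 c f) (h : ℝ) {x : E (m+1)}
    (hx : lastC x = h + f (epre x)) :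
    ∀ᶠ t in 𝓝[>] (0:ℝ),
      lastC (x - t • upN f (epre x)) ≤ h + f (epre (x - t • upN f (epre x))) := by
  filter_upwards [self_mem_nhdsWithin, (gt_mem_nhds (inv_pos.2 hc)).filter_mono nhdsWithin_le_nhds,
    (gt_mem_nhds one_pos).filter_mono nhdsWithin_le_nhds] with t ht htc ht1
  have ht : 0 < t := ht
  simp only [lastC_sub, lastC_smul, lastC_upN, epre_sub, epre_smul, epre_upN, smul_neg,
    sub_neg_eq_add, mul_one]
  have h1 := (abs_le.1 (hf.abs_sub_inner_le hc (epre x) (epre x + t • gradient f (epre x)))).1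
  rw [add_sub_cancel_left, real_inner_smul_right, real_inner_self_eq_norm_sq, norm_smul, mul_pow,
    Real.norm_eq_abs, sq_abs] at h1
  have h2 : c * t ≤ 1 := by
    have := mul_le_mul_of_nonneg_left htc.le hc.le
    rwa [mul_inv_cancel₀ hc.ne'] at this
  have h3 : c * t * (t * ‖gradient f (epre x)‖ ^ 2) ≤ t * ‖gradient f (epre x)‖ ^ 2 := by
    have : 0 ≤ t * ‖gradient f (epre x)‖ ^ 2 := by positivity
    nlinarith
  rw [hx]
  nlinarith

/-- The quadratic support property of the normal to the graph. -/
lemma C11.normal_support (hc : 0 < c) (hf : C11 c f) (h : ℝ) {x z : E (m+1)}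
    (hx : lastC x = h + f (epre x)) (hz : lastC z ≤ h + f (epre z)) :
    -c * ‖x - z‖ ^ 2 ≤ ⟪x - z, upN f (epre x)⟫ := by
  have h1 := (abs_le.1 (hf.abs_sub_inner_le hc (epre x) (epre z))).2
  have h2 := norm_epre_le (x - z)
  have h3 : ‖epre z - epre x‖ ^ 2 ≤ ‖x - z‖ ^ 2 := by
    rw [norm_sub_rev, ← epre_sub]
    exact pow_le_pow_left₀ (norm_nonneg _) h2 2
  have h4 : ⟪epre x - epre z, gradient f (epre x)⟫ = -⟪gradient f (epre x), epre z - epre x⟫ := by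
    rw [← inner_neg_right, neg_sub, real_inner_comm]
  rw [inner_eq_epre_lastC]
  simp only [epre_sub, epre_upN, inner_neg_right, lastC_sub, lastC_upN, mul_one, h4]
  nlinarith

end Graph

/-- The part `|x'| < R` of the closed slab `|x_n| ≤ ε/2 + f(x')`. -/
def slab {m : ℕ} (ε R : ℝ) (f : E m → ℝ) : Set (E (m+1)) :=
  {x | ‖epre x‖ < R ∧ |lastC x| ≤ ε / 2 + f (epre x)}

/-- The part `|x'| < R` of the open slab `|x_n| < ε/2 + f(x')`. -/
def openSlab {m : ℕ} (ε R : ℝ) (f : E m → ℝ) : Set (E (m+1)) :=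
  {x | ‖epre x‖ < R ∧ |lastC x| < ε / 2 + f (epre x)}

/-- An odd solution of the Robin problem in the symmetric slab, bounded by `M`. -/
structure OddRobin {m : ℕ} (ε R0 γ c M U : ℝ) (f : E m → ℝ) (u : E (m+1) → ℝ) : Prop where
  eps_pos : 0 < ε
  eps_lt : ε < R0 / 4
  c11 : C11 c f
  nonneg : ∀ p, ‖p‖ < R0 → 0 ≤ f p
  diff : ∀ x ∈ slab ε R0 f, DifferentiableAt ℝ u x
  cont : ContinuousOn (gradient u) (slab ε R0 f)
  contDiffAt : ∀ x ∈ openSlab ε R0 f, ContDiffAt ℝ 2 u x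
  harmonic : ∀ x ∈ openSlab ε R0 f, elap u x = 0
  robin : ∀ x, ‖epre x‖ < R0 → lastC x = ε / 2 + f (epre x) →
    γ * ⟪gradient u x, upN f (epre x)⟫ = Real.sqrt (1 + ‖gradient f (epre x)‖ ^ 2) * (U - u x)
  odd : ∀ x ∈ openSlab ε R0 f, u (reflLast x) = -u x
  bound : ∀ x ∈ slab ε R0 f, |u x| ≤ M

section Slab

variable {m : ℕ} {ε R : ℝ} {f : E m → ℝ}

lemma isOpen_openSlab (hf : Continuous f) : IsOpen (openSlab ε R f) :=
  (isOpen_lt continuous_epre.norm continuous_const).inter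
    (isOpen_lt continuous_lastC.abs (continuous_const.add (hf.comp continuous_epre)))

lemma openSlab_subset_slab : openSlab ε R f ⊆ slab ε R f := fun _ hx => ⟨hx.1, hx.2.le⟩

lemma neck_eq_openSlab : neck ε f (fun p => -f p) 0 R = openSlab ε R f := by
  ext x
  simp only [neck, openSlab, sub_zero, Set.mem_ofPred_eq, abs_lt]
  constructor
  · rintro ⟨h1, h2, h3⟩; exact ⟨h1, by linarith, h3⟩
  · rintro ⟨h1, h2, h3⟩; exact ⟨h1, by linarith, h3⟩

lemma slab_subset_regio (hpos : ∀ p, ‖p‖ < R → 0 < ε / 2 + f p) :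
    slab ε R f ⊆ regio ε R f (fun p => -f p) := by
  rintro x ⟨h1, h2⟩
  rcases h2.lt_or_eq with h | h
  · left; left; rw [neck_eq_openSlab]; exact ⟨h1, h⟩
  · rcases (abs_eq (hpos _ h1).le).1 h with h | h
    · left; right
      exact ⟨epre x, by simpa using h1, by
        show eglue (epre x) (ε / 2 + f (epre x)) = x
        rw [← h]; exact eglue_epre_lastC x⟩
    · right
      exact ⟨epre x, by simpa using h1, by
        show eglue (epre x) (-(ε / 2) + -f (epre x)) = x
        rw [show -(ε / 2) + -f (epre x) = lastC x by rw [h]; ring]; exact eglue_epre_lastC x⟩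

lemma slab_subset_closure_openSlab (hpos : ∀ p, ‖p‖ < R → 0 < ε / 2 + f p) :
    slab ε R f ⊆ closure (openSlab ε R f) := by
  rintro x ⟨h1, h2⟩
  have hlim : Tendsto (fun t : ℝ => eglue (epre x) (t * lastC x)) (𝓝[<] 1) (𝓝 x) := by
    have hc : Continuous (fun t : ℝ => eglue (epre x) (t * lastC x)) := by
      have : (fun t : ℝ => eglue (epre x) (t * lastC x)) =
          fun t : ℝ => eglue (epre x) 0 + (0:ℝ) • eglue (0 : E m) 0 + (t * lastC x) • vert m := by
        funext t
        rw [← eglue_line, smul_zero, add_zero]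
      rw [this]
      fun_prop
    have := hc.tendsto 1
    rw [one_mul, eglue_epre_lastC] at this
    exact this.mono_left nhdsWithin_le_nhds
  refine mem_closure_of_tendsto hlim ?_
  filter_upwards [self_mem_nhdsWithin, (lt_mem_nhds (zero_lt_one' ℝ)).filter_mono
    nhdsWithin_le_nhds] with t ht ht0
  have ht : t < 1 := ht
  refine ⟨by simpa using h1, ?_⟩
  rw [lastC_eglue, epre_eglue, abs_mul, abs_of_pos ht0]
  have := hpos _ h1
  nlinarith [abs_nonneg (lastC x)]

lemma isCompact_closedSlab {H : ℝ} (hf : Continuous f) (hH : ∀ p, ε / 2 + f p ≤ H) :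
    IsCompact {x : E (m+1) | ‖epre x‖ ≤ R ∧ |lastC x| ≤ ε / 2 + f (epre x)} := by
  refine Metric.isCompact_of_isClosed_isBounded ?_ ?_
  · exact (isClosed_le continuous_epre.norm continuous_const).inter
      (isClosed_le continuous_lastC.abs (continuous_const.add (hf.comp continuous_epre)))
  · refine (isBounded_closedBall (x := (0 : E (m+1))) (r := |R| + |H|)).subset ?_
    rintro x ⟨h1, h2⟩
    rw [mem_closedBall_zero_iff]
    refine le_of_sq_le_sq ?_ (by positivity)
    have h3 : |lastC x| ≤ |H| := h2.trans ((hH _).trans (le_abs_self H))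
    have h4 : ‖epre x‖ ≤ |R| := h1.trans (le_abs_self R)
    rw [norm_sq_eq_epre_lastC, ← sq_abs (lastC x)]
    nlinarith [norm_nonneg (epre x), abs_nonneg (lastC x), abs_nonneg R, abs_nonneg H]

@[simp] lemma epre_reflLast (x : E (m+1)) : epre (reflLast x) = epre x := epre_eglue _ _
@[simp] lemma lastC_reflLast (x : E (m+1)) : lastC (reflLast x) = -lastC x := lastC_eglue _ _

lemma reflLast_mem_openSlab {x : E (m+1)} (hx : x ∈ openSlab ε R f) :
    reflLast x ∈ openSlab ε R f := by
  simpa [openSlab] using hx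

end Slab

section Barrier

variable {m : ℕ} {ε R0 γ c M U : ℝ} {f : E m → ℝ} {u : E (m+1) → ℝ}

lemma hasDerivAt_line_of_differentiableAt {n : ℕ} {v : E n → ℝ} {x : E n}
    (hv : DifferentiableAt ℝ v x) (ξ : E n) :
    HasDerivAt (fun t : ℝ => v (x + t • ξ)) ⟪gradient v x, ξ⟫ 0 := by
  have hl : HasDerivAt (fun t : ℝ => x + t • ξ) ξ 0 := by
    simpa using ((hasDerivAt_id (0:ℝ)).smul_const ξ).const_add x
  have hf : HasFDerivAt v (fderiv ℝ v x) (x + (0:ℝ) • ξ) := by simpa using hv.hasFDerivAt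
  rw [inner_gradient_eq]
  exact hf.comp_hasDerivAt (0:ℝ) hl

lemma gradient_neg_fun {n : ℕ} (v : E n → ℝ) (x : E n) :
    gradient (fun y => -v y) x = -gradient v x := by
  simp [gradient, fderiv_fun_neg]

lemma OddRobin.neg (h : OddRobin ε R0 γ c M U f u) :
    OddRobin ε R0 γ c M (-U) f (fun x => -u x) where
  eps_pos := h.eps_pos
  eps_lt := h.eps_lt
  c11 := h.c11
  nonneg := h.nonneg
  diff x hx := (h.diff x hx).neg
  cont := by
    have : gradient (fun x => -u x) = fun x => -gradient u x := funext (gradient_neg_fun u)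
    rw [this]
    exact h.cont.neg
  contDiffAt x hx := (h.contDiffAt x hx).neg
  harmonic x hx := by
    have h1 := h.harmonic x hx
    have h2 : (fun x => -u x) = -u := rfl
    unfold elap at h1 ⊢
    simp only [h2, iteratedFDeriv_neg_apply, _root_.neg_apply,
      Finset.sum_neg_distrib, h1, neg_zero]
  robin x hx hx2 := by
    rw [gradient_neg_fun, inner_neg_left]
    have := h.robin x hx hx2
    linarith
  odd x hx := by rw [h.odd x hx]
  bound x hx := by rw [abs_neg]; exact h.bound x hx

lemma OddRobin.height_pos (h : OddRobin ε R0 γ c M U f u) {p : E m} (hp : ‖p‖ < R0) :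
    0 < ε / 2 + f p := by
  have := h.nonneg p hp
  have := h.eps_pos
  linarith

lemma OddRobin.continuousOn (h : OddRobin ε R0 γ c M U f u) : ContinuousOn u (slab ε R0 f) :=
  fun x hx => (h.diff x hx).continuousAt.continuousWithinAt

/-- The comparison function for the linear vanishing of `u` on the symmetry plane. -/
def barrier (A B : ℝ) (p0 : E m) (x : E (m+1)) : ℝ :=
  A * lastC x + B * (‖epre x - p0‖ ^ 2 - (m + 1) * lastC x ^ 2)

lemma barrier_add_smul (A B t : ℝ) (p0 : E m) (x ξ : E (m+1)) :
    barrier A B p0 (x + t • ξ) = barrier A B p0 x +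
      (A * lastC ξ + 2 * B * (⟪epre x - p0, epre ξ⟫ - (m + 1) * (lastC x * lastC ξ))) * t +
      B * (‖epre ξ‖ ^ 2 - (m + 1) * lastC ξ ^ 2) * t ^ 2 := by
  have h : epre (x + t • ξ) - p0 = (epre x - p0) + t • epre ξ := by
    simp only [epre_add, epre_smul]; abel
  rw [barrier, barrier, h, norm_add_sq_real, real_inner_smul_right, norm_smul, mul_pow,
    Real.norm_eq_abs, sq_abs, lastC_add, lastC_smul]
  ring

lemma continuous_barrier (A B : ℝ) (p0 : E m) : Continuous (barrier A B p0) := by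
  unfold barrier
  have := continuous_lastC (m := m)
  have := continuous_epre (m := m)
  fun_prop

/-- A function lying below a barrier near a point of contact is strictly superharmonic there. -/
lemma elap_neg_of_isLocalMax_sub_barrier {A B : ℝ} {p0 : E m} {z : E (m+1)} (hB : 0 < B)
    (hu : ContDiffAt ℝ 2 u z) (hmax : IsLocalMax (fun x => u x - barrier A B p0 x) z) :
    elap u z < 0 := by
  have key : ∀ ξ : E (m+1), iteratedFDeriv ℝ 2 u z ![ξ, ξ] ≤
      2 * (B * (‖epre ξ‖ ^ 2 - (m + 1) * lastC ξ ^ 2)) := by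
    intro ξ
    refine iteratedFDeriv_le_of_le_quadratic (α := A * lastC ξ + 2 * B *
      (⟪epre z - p0, epre ξ⟫ - (m + 1) * (lastC z * lastC ξ))) hu ?_
    have hc : Tendsto (fun t : ℝ => z + t • ξ) (𝓝 0) (𝓝 z) := by
      have : Continuous (fun t : ℝ => z + t • ξ) := by fun_prop
      simpa using this.tendsto 0
    filter_upwards [hc.eventually hmax] with t ht
    rw [barrier_add_smul] at ht
    linarith
  have h1 : ∀ i : Fin m, iteratedFDeriv ℝ 2 u z ![EuclideanSpace.single i.castSucc 1,
      EuclideanSpace.single i.castSucc 1] ≤ 2 * B := by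
    intro i
    refine (key _).trans (le_of_eq ?_)
    have h2 : epre (EuclideanSpace.single i.castSucc (1:ℝ)) = EuclideanSpace.single i 1 := by
      ext j; simp
    have h3 : lastC (EuclideanSpace.single i.castSucc (1:ℝ)) = 0 := by
      simp [lastC, (Fin.castSucc_lt_last i).ne']
    rw [h2, h3]; simp
  have h4 : iteratedFDeriv ℝ 2 u z ![EuclideanSpace.single (Fin.last m) 1,
      EuclideanSpace.single (Fin.last m) 1] ≤ -(2 * B * (m + 1)) := by
    refine (key _).trans (le_of_eq ?_)
    have h2 : epre (EuclideanSpace.single (Fin.last m) (1:ℝ)) = 0 := by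
      ext j; simp [(Fin.castSucc_lt_last j).ne]
    have h3 : lastC (EuclideanSpace.single (Fin.last m) (1:ℝ)) = 1 := by simp [lastC]
    rw [h2, h3]; simp; ring
  rw [elap, Fin.sum_univ_castSucc]
  have h5 := Finset.sum_le_sum fun i (_ : i ∈ (Finset.univ : Finset (Fin m))) => h1 i
  simp only [Finset.sum_const, Finset.card_univ, Fintype.card_fin, nsmul_eq_mul] at h5
  linarith

lemma OddRobin.eq_zero_of_lastC (h : OddRobin ε R0 γ c M U f u) {z : E (m+1)}
    (hz : ‖epre z‖ < R0) (h0 : lastC z = 0) : u z = 0 := by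
  have h1 : z ∈ openSlab ε R0 f := ⟨hz, by rw [h0, abs_zero]; exact h.height_pos hz⟩
  have h2 : reflLast z = z := by
    rw [reflLast, h0, neg_zero, ← h0, eglue_epre_lastC]
  have := h.odd z h1
  rw [h2] at this
  linarith

lemma sqrt_one_add_sq_le {a b : ℝ} (ha : 0 ≤ a) (hab : a ≤ b) :
    Real.sqrt (1 + a ^ 2) ≤ Real.sqrt (1 + b ^ 2) := by
  apply Real.sqrt_le_sqrt
  nlinarith

lemma OddRobin.le_mul_lastC (h : OddRobin ε R0 γ c M U f u) (hγ : 0 < γ) (hc : 0 < c)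
    (hM : 0 < M) {r H A : ℝ} (hr : 0 < r) (hH : ∀ p, ε / 2 + f p ≤ H)
    (hA : Real.sqrt (1 + c ^ 2) * |U| / γ + 2 * (m + 1) * (M / r ^ 2) * H + 2 * (M / r ^ 2) * r * c
      + M ≤ A) {x : E (m+1)} (hxr : ‖epre x‖ + r < R0) (hx0 : 0 ≤ lastC x)
    (hx : lastC x ≤ ε / 2 + f (epre x)) : u x ≤ A * lastC x := by
  set p0 := epre x with hp0
  set B := M / r ^ 2 with hBdef
  have hB : 0 < B := by positivity
  have hBr : B * r ^ 2 = M := by rw [hBdef]; field_simp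
  set Q := Real.sqrt (1 + c ^ 2)
  have hUQ : 0 ≤ Q * |U| / γ := by positivity
  have hHpos : 0 < H := (h.height_pos (by linarith : ‖p0‖ < R0)).trans_le (hH p0)
  have hBH : 0 < (m + 1) * B * H := by positivity
  have hBrc : 0 < B * r * c := by positivity
  set K := {z : E (m+1) | ‖epre z - p0‖ ≤ r ∧ 0 ≤ lastC z ∧ lastC z ≤ ε / 2 + f (epre z)} with hK
  have hpre : ∀ z : E (m+1), ‖epre z - p0‖ ≤ r → ‖epre z‖ < R0 := fun z hz => by
    have := norm_sub_norm_le (epre z) p0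
    linarith
  have hKs : K ⊆ slab ε R0 f := fun z hz =>
    ⟨hpre z hz.1, by rw [abs_of_nonneg hz.2.1]; exact hz.2.2⟩
  have hKc : IsCompact K := by
    refine (isCompact_closedSlab (R := R0) h.c11.continuous hH).of_isClosed_subset ?_
      fun z hz => ⟨(hKs hz).1.le, (hKs hz).2⟩
    exact (isClosed_le (continuous_epre.sub continuous_const).norm continuous_const).inter
      ((isClosed_le continuous_const continuous_lastC).inter
        (isClosed_le continuous_lastC (continuous_const.add (h.c11.continuous.comp continuous_epre))))
  have hxK : x ∈ K := ⟨by simpa [hp0] using hr.le, hx0, hx⟩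
  obtain ⟨z, hzK, hmax⟩ := hKc.exists_isMaxOn ⟨x, hxK⟩
    ((h.continuousOn.mono hKs).sub (continuous_barrier A B p0).continuousOn)
  have hmax' : ∀ y ∈ K, u y - barrier A B p0 y ≤ u z - barrier A B p0 z := fun y hy => hmax hy
  have hzR := hpre z hzK.1
  have hzH : lastC z ≤ H := hzK.2.2.trans (hH _)
  have hz0 : 0 ≤ lastC z := hzK.2.1
  have hBz : (m + 1) * B * lastC z ≤ (m + 1) * B * H :=
    mul_le_mul_of_nonneg_left hzH (by positivity)
  have hmz := mul_nonneg hz0 (by linarith : 0 ≤ A - (m + 1) * B * lastC z)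
  have hzB : 0 ≤ B * ‖epre z - p0‖ ^ 2 := by positivity
  suffices hle : u z - barrier A B p0 z ≤ 0 by
    have h1 := (hmax' x hxK).trans hle
    have h2 : 0 ≤ B * ((m + 1) * lastC x ^ 2) := by positivity
    simp only [barrier, ← hp0, sub_self, norm_zero] at h1
    linarith
  by_contra! hpos
  have huz : 0 < u z := by
    unfold barrier at hpos
    linarith
  have hzl : 0 < lastC z := by
    refine lt_of_le_of_ne hz0 fun h0 => ?_
    have := h.eq_zero_of_lastC hzR h0.symm
    linarith
  have hzr : ‖epre z - p0‖ < r := by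
    refine lt_of_le_of_ne hzK.1 fun h0 => ?_
    have h1 := (abs_le.1 (h.bound z (hKs hzK))).2
    rw [barrier, h0] at hpos
    linarith
  rcases hzK.2.2.lt_or_eq with hlt | heq
  · have hzo : z ∈ openSlab ε R0 f := ⟨hzR, by rwa [abs_of_pos hzl]⟩
    have hKn : K ∈ 𝓝 z := by
      have h1 : ∀ᶠ y in 𝓝 z, ‖epre y - p0‖ < r :=
        (continuous_epre.sub continuous_const).norm.continuousAt.eventually_lt
          continuousAt_const hzr
      have h2 : ∀ᶠ y in 𝓝 z, 0 < lastC y :=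
        continuousAt_const.eventually_lt continuous_lastC.continuousAt hzl
      have h3 : ∀ᶠ y in 𝓝 z, lastC y < ε / 2 + f (epre y) :=
        continuous_lastC.continuousAt.eventually_lt
          (continuous_const.add (h.c11.continuous.comp continuous_epre)).continuousAt hlt
      filter_upwards [h1, h2, h3] with y a b d using ⟨a.le, b.le, d.le⟩
    have := elap_neg_of_isLocalMax_sub_barrier hB (h.contDiffAt z hzo)
      (by filter_upwards [hKn] with y hy using hmax' y hy)
    rw [h.harmonic z hzo] at this
    exact lt_irrefl _ this
  · set N := upN f (epre z) with hN
    have hd := hasDerivAt_line_of_differentiableAt (h.diff z (hKs hzK)) (-N)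
    have hlc : Tendsto (fun t : ℝ => z + t • -N) (𝓝 0) (𝓝 z) := by
      have : Continuous (fun t : ℝ => z + t • -N) := by fun_prop
      simpa using this.tendsto 0
    have h1 : ∀ᶠ y in 𝓝 z, ‖epre y - p0‖ < r :=
      (continuous_epre.sub continuous_const).norm.continuousAt.eventually_lt
        continuousAt_const hzr
    have h2 : ∀ᶠ y in 𝓝 z, 0 < lastC y :=
      continuousAt_const.eventually_lt continuous_lastC.continuousAt hzl
    have hle := deriv_le_of_le_quadratic (α := A * lastC (-N) + 2 * B *
      (⟪epre z - p0, epre (-N)⟫ - (m + 1) * (lastC z * lastC (-N))))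
      (β := B * (‖epre (-N)‖ ^ 2 - (m + 1) * lastC (-N) ^ 2)) hd (by
        filter_upwards [h.c11.eventually_below hc _ heq, (hlc.eventually h1).filter_mono
          nhdsWithin_le_nhds, (hlc.eventually h2).filter_mono nhdsWithin_le_nhds] with t a b d
        have he : z - t • upN f (epre z) = z + t • -N := by rw [smul_neg, sub_eq_add_neg]
        rw [he] at a
        have := hmax' _ ⟨b.le, d.le, a⟩
        rw [barrier_add_smul] at this
        rw [zero_smul, add_zero]
        linarith)
    have e1 : epre (-N) = gradient f (epre z) := by
      rw [← neg_one_smul ℝ N, epre_smul, hN, epre_upN]; simp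
    have e2 : lastC (-N) = -1 := by
      rw [← neg_one_smul ℝ N, lastC_smul, hN, lastC_upN]; simp
    rw [e1, e2, inner_neg_right] at hle
    have hrob := h.robin z hzR heq
    rw [← hN] at hrob
    have hin : ⟪epre z - p0, gradient f (epre z)⟫ ≤ r * c :=
      (real_inner_le_norm _ _).trans (mul_le_mul hzr.le (h.c11.2.2.1 _) (norm_nonneg _) hr.le)
    have hq : ⟪gradient u z, N⟫ ≤ Q * |U| / γ := by
      rw [le_div_iff₀ hγ, mul_comm, hrob]
      refine (mul_le_mul_of_nonneg_left (c := |U|) ?_ (Real.sqrt_nonneg _)).trans ?_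
      · linarith [le_abs_self U]
      · exact mul_le_mul_of_nonneg_right
          (sqrt_one_add_sq_le (norm_nonneg _) (h.c11.2.2.1 _)) (abs_nonneg U)
    have h3 := mul_le_mul_of_nonneg_left hin hB.le
    linarith

lemma OddRobin.abs_le_mul_lastC (h : OddRobin ε R0 γ c M U f u) (hγ : 0 < γ) (hc : 0 < c)
    (hM : 0 < M) {r H A : ℝ} (hr : 0 < r) (hH : ∀ p, ε / 2 + f p ≤ H)
    (hA : Real.sqrt (1 + c ^ 2) * |U| / γ + 2 * (m + 1) * (M / r ^ 2) * H + 2 * (M / r ^ 2) * r * c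
      + M ≤ A) {x : E (m+1)} (hxr : ‖epre x‖ + r < R0)
    (hx : -(ε / 2 + f (epre x)) < lastC x) (hx' : lastC x ≤ ε / 2 + f (epre x)) :
    |u x| ≤ A * |lastC x| := by
  have key : ∀ y : E (m+1), ‖epre y‖ + r < R0 → 0 ≤ lastC y → lastC y ≤ ε / 2 + f (epre y) →
      |u y| ≤ A * lastC y := fun y h1 h2 h3 => by
    have h4 := h.le_mul_lastC hγ hc hM hr hH hA h1 h2 h3
    have h5 := h.neg.le_mul_lastC hγ hc hM hr hH (A := A) (by rwa [abs_neg]) h1 h2 h3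
    exact abs_le.2 ⟨by linarith, h4⟩
  rcases le_total 0 (lastC x) with h0 | h0
  · rw [abs_of_nonneg h0]
    exact key x hxr h0 hx'
  · have hpos := h.height_pos (by linarith : ‖epre x‖ < R0)
    have h1 : x ∈ openSlab ε R0 f := ⟨by linarith, abs_lt.2 ⟨hx, by linarith⟩⟩
    have h2 := key (reflLast x) (by rwa [epre_reflLast])
      (by rw [lastC_reflLast]; linarith) (by rw [lastC_reflLast, epre_reflLast]; linarith)
    rw [h.odd x h1, abs_neg, lastC_reflLast] at h2
    rwa [abs_of_nonpos h0]

end Barrier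

section Local

variable {m : ℕ} {ε R0 γ c M U : ℝ} {f : E m → ℝ} {u : E (m+1) → ℝ}

/-- The horizontal inclusion `p ↦ (p, 0)`. -/
def horiz (m : ℕ) : E m →L[ℝ] E (m+1) :=
  LinearMap.toContinuousLinearMap
    { toFun := fun p => eglue p 0
      map_add' := fun p q => by
        ext i; refine Fin.lastCases ?_ (fun j => ?_) i <;> simp
      map_smul' := fun t p => by
        ext i; refine Fin.lastCases ?_ (fun j => ?_) i <;> simp }

lemma horiz_add_smul_vert (p : E m) (t : ℝ) : horiz m p + t • vert m = eglue p t := by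
  have := eglue_line p 0 0 t
  rw [smul_zero, add_zero, zero_smul, add_zero] at this
  exact this.symm

lemma norm_gradient_eq {n : ℕ} (v : E n → ℝ) (x : E n) : ‖fderiv ℝ v x‖ = ‖gradient v x‖ := by
  simp [gradient]

/-- A gradient bound along the graph of `f` gives a Lipschitz bound there. -/
lemma abs_sub_le_of_norm_gradient_le_graph (hf : C11 c f) (h : ℝ) {s : Set (E m)}
    (hs : Convex ℝ s) {G : ℝ} (hG : 0 ≤ G)
    (hd : ∀ p ∈ s, DifferentiableAt ℝ u (eglue p (h + f p)))
    (hb : ∀ p ∈ s, ‖gradient u (eglue p (h + f p))‖ ≤ G) {p q : E m} (hp : p ∈ s) (hq : q ∈ s) :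
    |u (eglue q (h + f q)) - u (eglue p (h + f p))| ≤
      G * Real.sqrt (1 + c ^ 2) * ‖q - p‖ := by
  set g' : E m → (E m →L[ℝ] ℝ) := fun p =>
    (fderiv ℝ u (eglue p (h + f p))).comp (horiz m + (fderiv ℝ f p).smulRight (vert m)) with hg'
  have h1 : ∀ p ∈ s, HasFDerivWithinAt (fun p => u (eglue p (h + f p))) (g' p) s p := by
    intro p hp
    have e : (fun p => u (eglue p (h + f p))) = u ∘ fun p => horiz m p + (h + f p) • vert m :=
      funext fun p => by simp [horiz_add_smul_vert]
    have h2 : HasFDerivAt (fun p => horiz m p + (h + f p) • vert m)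
        (horiz m + (fderiv ℝ f p).smulRight (vert m)) p :=
      (horiz m).hasFDerivAt.add (((hf.1 p).hasFDerivAt.const_add h).smul_const (vert m))
    have h3 := (hd p hp).hasFDerivAt
    rw [e]
    rw [← horiz_add_smul_vert] at h3
    have h4 := (h3.comp p h2).hasFDerivWithinAt (s := s)
    rwa [horiz_add_smul_vert] at h4
  have h2 : ∀ p ∈ s, ‖g' p‖ ≤ G * Real.sqrt (1 + c ^ 2) := by
    intro p hp
    refine ContinuousLinearMap.opNorm_le_bound _ (by positivity) fun v => ?_
    have e : (horiz m + (fderiv ℝ f p).smulRight (vert m)) v = eglue v (fderiv ℝ f p v) := by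
      rw [← horiz_add_smul_vert]; simp
    rw [hg', ContinuousLinearMap.comp_apply, e]
    refine (ContinuousLinearMap.le_opNorm _ _).trans ?_
    rw [norm_gradient_eq, mul_assoc]
    refine mul_le_mul (hb p hp) ?_ (norm_nonneg _) hG
    have h5 : ‖fderiv ℝ f p v‖ ≤ c * ‖v‖ := by
      refine (ContinuousLinearMap.le_opNorm _ _).trans ?_
      rw [norm_gradient_eq]
      exact mul_le_mul_of_nonneg_right (hf.2.2.1 p) (norm_nonneg v)
    refine le_of_sq_le_sq ?_ (by positivity)
    rw [norm_sq_eq_epre_lastC, epre_eglue, lastC_eglue, mul_pow,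
      Real.sq_sqrt (by positivity), ← sq_abs (fderiv ℝ f p v), ← Real.norm_eq_abs]
    have := pow_le_pow_left₀ (norm_nonneg _) h5 2
    linarith
  have := Convex.norm_image_sub_le_of_norm_hasFDerivWithin_le h1 h2 hs hp hq
  rwa [Real.norm_eq_abs] at this

lemma abs_sqrt_one_add_sq_sub_le (a b : ℝ) :
    |Real.sqrt (1 + a ^ 2) - Real.sqrt (1 + b ^ 2)| ≤ |a - b| := by
  have ha := Real.sq_sqrt (by positivity : (0:ℝ) ≤ 1 + a ^ 2)
  have hb := Real.sq_sqrt (by positivity : (0:ℝ) ≤ 1 + b ^ 2)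
  have hab : 1 + a * b ≤ Real.sqrt (1 + a ^ 2) * Real.sqrt (1 + b ^ 2) := by
    rw [← Real.sqrt_mul (by positivity)]
    apply Real.le_sqrt_of_sq_le
    nlinarith [sq_nonneg (a - b)]
  rw [← sq_le_sq]
  nlinarith

lemma OddRobin.norm_gradient_le_local (h : OddRobin ε R0 γ c M U f u) (hγ : 0 < γ) (hc : 0 < c)
    {R K A ρ : ℝ} (hR : R < R0) (hM : 0 < M)
    (hK : ∀ x : E (m+1), ‖epre x‖ ≤ R → |lastC x| ≤ ε / 2 + f (epre x) →
      (R - ‖epre x‖) * ‖gradient u x‖ ≤ K)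
    (hA0 : 0 ≤ A)
    (hA : ∀ x : E (m+1), ‖epre x‖ ≤ R → -(ε / 2 + f (epre x)) < lastC x →
      lastC x ≤ ε / 2 + f (epre x) → |u x| ≤ A * |lastC x|)
    {x0 : E (m+1)} (hx0 : x0 ∈ openSlab ε R f) (hx00 : 0 ≤ lastC x0) (hρ : 0 < ρ)
    (hρ1 : 16 * c * ρ ≤ 1) (hρ2 : 2 * (1 + c) * ρ ≤ ε / 2 + f (epre x0))
    (hρ3 : 2 * ρ ≤ R - ‖epre x0‖) :
    ‖gradient u x0‖ ≤ 40 * (m + 1) * (4 * ((c * (M + |U|) + 2 * K * (1 + c ^ 2) /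
        (R - ‖epre x0‖)) / γ) * ρ +
      2 * (2 * A * (ε / 2 + f (epre x0)) + Real.sqrt (1 + c ^ 2) * (M + |U|) / γ * ρ) / ρ) +
      Real.sqrt (1 + c ^ 2) * (M + |U|) / γ := by
  set p0 := epre x0 with hp0
  set φ0 := ε / 2 + f p0 with hφ0
  set d0 := R - ‖p0‖ with hd0
  set Q := Real.sqrt (1 + c ^ 2) with hQ
  set S := M + |U| with hS
  have hQ2 : Q * Q = 1 + c ^ 2 := Real.mul_self_sqrt (by positivity)
  have hQ0 : 0 ≤ Q := Real.sqrt_nonneg _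
  have hSp : 0 < S := by positivity
  have hd0p : 0 < d0 := by linarith
  have hcρ : 0 < c * ρ := by positivity
  have hφ0p : 0 < φ0 := by linarith
  have hK0 : 0 ≤ K := (mul_nonneg hd0p.le (norm_nonneg _)).trans (hK x0 hx0.1.le hx0.2.le)
  have hfp : ∀ p, ‖p - p0‖ ≤ ρ → |f p - f p0| ≤ c * ρ := fun p hp =>
    (h.c11.abs_sub_le p0 p).trans (mul_le_mul_of_nonneg_left hp hc.le)
  have hpR : ∀ p, ‖p - p0‖ ≤ ρ → ‖p‖ ≤ R - d0 / 2 := fun p hp => by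
    have := norm_sub_norm_le p p0
    linarith
  set x1 := eglue p0 φ0 with hx1
  set H0 := Real.sqrt (1 + ‖gradient f p0‖ ^ 2) * (U - u x1) / γ with hH0
  set hh := Q * S / γ with hhh
  have hslab1 : ∀ p, ‖p - p0‖ ≤ ρ → eglue p (ε / 2 + f p) ∈ slab ε R0 f := fun p hp => by
    have h1 : ‖p‖ < R0 := by linarith [hpR p hp]
    exact ⟨by rwa [epre_eglue], by
      rw [epre_eglue, lastC_eglue, abs_of_pos (h.height_pos h1)]⟩
  have hp00 : ‖p0 - p0‖ ≤ ρ := by simpa using hρ.le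
  have hUu : ∀ x ∈ slab ε R0 f, |U - u x| ≤ S := fun x hx => by
    have h1 := abs_sub U (u x)
    have h2 := h.bound x hx
    linarith
  have hqQ : ∀ p, Real.sqrt (1 + ‖gradient f p‖ ^ 2) ≤ Q := fun p =>
    sqrt_one_add_sq_le (norm_nonneg _) (h.c11.2.2.1 p)
  have hH0h : |H0| ≤ hh := by
    rw [hH0, abs_div, abs_of_pos hγ, abs_mul, abs_of_nonneg (Real.sqrt_nonneg _)]
    refine div_le_div_of_nonneg_right ?_ hγ.le
    exact mul_le_mul (hqQ p0) (hUu _ (hslab1 p0 hp00)) (abs_nonneg _) hQ0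
  set Er := (c * S + 2 * K * (1 + c ^ 2) / d0) / γ with hEr
  have hErp : 0 < Er := by positivity
  set D := {x : E (m+1) | lastC x ≤ ε / 2 + f (epre x)} with hD
  have hDn : ∀ x : E (m+1), lastC x < ε / 2 + f (epre x) → D ∈ 𝓝 x := fun x hx => by
    have h3 : ∀ᶠ y in 𝓝 x, lastC y < ε / 2 + f (epre y) :=
      continuous_lastC.continuousAt.eventually_lt
        (continuous_const.add (h.c11.continuous.comp continuous_epre)).continuousAt hx
    filter_upwards [h3] with y hy using hy.le
  have hball : ∀ x : E (m+1), ‖x - x0‖ ≤ ρ → x ∈ D → ‖epre x - p0‖ ≤ ρ ∧ ‖epre x‖ ≤ R ∧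
      -(ε / 2 + f (epre x)) < lastC x ∧ |lastC x| ≤ 2 * φ0 := fun x hx hxD => by
    have h1 : ‖epre x - p0‖ ≤ ρ := by
      rw [hp0, ← epre_sub]; exact (norm_epre_le _).trans hx
    have h2 := abs_le.1 ((abs_lastC_le (x - x0)).trans hx)
    rw [lastC_sub] at h2
    have h3 := abs_le.1 (hfp _ h1)
    have hxD : lastC x ≤ ε / 2 + f (epre x) := hxD
    refine ⟨h1, by linarith [hpR _ h1], by linarith, abs_le.2 ⟨by linarith, by linarith⟩⟩
  have hslab : ∀ x ∈ D ∩ closedBall x0 ρ, x ∈ slab ε R0 f := fun x hx => by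
    obtain ⟨h1, h2, h3, h4⟩ := hball x (by simpa [dist_eq_norm] using hx.2) hx.1
    exact ⟨by linarith, abs_le.2 ⟨h3.le, hx.1⟩⟩
  have hx0R : x0 ∈ slab ε R0 f := ⟨hx0.1.trans hR, hx0.2.le⟩
  have hna : ∀ y : E (m+1), ⟪H0 • vert m, y⟫ = H0 * lastC y := fun y => by
    rw [real_inner_smul_left, real_inner_comm, inner_vert]
  have hgraph : ∀ p, ‖p - p0‖ ≤ ρ →
      |u (eglue p (ε / 2 + f p)) - u x1| ≤ 2 * K / d0 * Q * ‖p - p0‖ := fun p hp => by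
    refine abs_sub_le_of_norm_gradient_le_graph (s := closedBall p0 ρ) h.c11 (ε / 2)
      (convex_closedBall p0 ρ) (by positivity) (fun q hq => ?_) (fun q hq => ?_)
      (mem_closedBall_self hρ.le) (by simpa [dist_eq_norm] using hp)
    · exact h.diff _ (hslab1 q (by simpa [dist_eq_norm] using hq))
    · have hq : ‖q - p0‖ ≤ ρ := by simpa [dist_eq_norm] using hq
      have h1 := hpR q hq
      have h2 := hK (eglue q (ε / 2 + f q)) (by rw [epre_eglue]; linarith)
        ((hslab1 q hq).2)
      rw [epre_eglue] at h2
      rw [le_div_iff₀ hd0p]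
      have h3 := mul_le_mul_of_nonneg_right (by linarith : d0 / 2 ≤ R - ‖q‖)
        (norm_nonneg (gradient u (eglue q (ε / 2 + f q))))
      linarith
  have hfin := norm_gradient_le_of_neumannPoint (n := m + 1) (ρ := ρ) (c := c) (Er := Er)
    (W := 2 * A * φ0 + hh * ρ) (k := vert m) (x0 := x0) (a := H0 • vert m) (u := u) (D := D)
    norm_vert hρ hc hρ1 hErp
    (isClosed_le continuous_lastC (continuous_const.add (h.c11.continuous.comp continuous_epre)))
    (hDn x0 (abs_lt.1 hx0.2).2) (h.continuousOn.mono hslab) (h.diff x0 hx0R) ?_ ?_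
  · rw [norm_smul, norm_vert, mul_one, Real.norm_eq_abs] at hfin
    push_cast at hfin
    linarith
  · intro x hx
    have hxρ : ‖x - x0‖ ≤ ρ := by simpa [dist_eq_norm] using hx.2
    obtain ⟨h1, h2, h3, h4⟩ := hball x hxρ hx.1
    have h5 := hA x h2 h3 hx.1
    have h6 := mul_le_mul_of_nonneg_left h4 hA0
    have h7 : |⟪H0 • vert m, x - x0⟫| ≤ hh * ρ := by
      rw [hna, abs_mul]
      exact mul_le_mul hH0h ((abs_lastC_le _).trans hxρ) (abs_nonneg _) (by positivity)
    have h8 := abs_sub (u x) ⟪H0 • vert m, x - x0⟫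
    linarith
  · intro x hxD hxρ
    obtain ⟨h1, h2, h3, h4⟩ := hball x hxρ.le hxD
    have hxs : x ∈ slab ε R0 f := ⟨by linarith, abs_le.2 ⟨h3.le, hxD⟩⟩
    rcases (show lastC x ≤ ε / 2 + f (epre x) from hxD).lt_or_eq with hlt | heq
    · left
      have hxo : x ∈ openSlab ε R0 f := ⟨by linarith, abs_lt.2 ⟨h3, hlt⟩⟩
      exact ⟨hDn x hlt, h.contDiffAt x hxo, h.harmonic x hxo⟩
    · right
      refine ⟨upN f (epre x), ⟪gradient u x, upN f (epre x)⟫, by rw [inner_vert, lastC_upN],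
        fun z hz => h.c11.normal_support hc _ heq hz, h.c11.eventually_below hc _ heq, ?_, ?_⟩
      · have := hasDerivAt_line_of_differentiableAt (h.diff x hxs) (-upN f (epre x))
        rw [inner_neg_right] at this
        simpa only [smul_neg, ← sub_eq_add_neg] using this
      · have hrob := h.robin x hxs.1 heq
        have hgr := hgraph (epre x) h1
        rw [← heq, eglue_epre_lastC] at hgr
        have hq := abs_sqrt_one_add_sq_sub_le ‖gradient f (epre x)‖ ‖gradient f p0‖
        have hq' := (hq.trans (abs_norm_sub_norm_le _ _)).trans
          (h.c11.norm_gradient_sub_le hc (epre x) p0)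
        have hxx : ‖epre x - p0‖ ≤ ‖x - x0‖ := by
          rw [hp0, ← epre_sub]; exact norm_epre_le _
        set q := Real.sqrt (1 + ‖gradient f (epre x)‖ ^ 2)
        set q0 := Real.sqrt (1 + ‖gradient f p0‖ ^ 2)
        have hq00 : 0 ≤ q0 := Real.sqrt_nonneg _
        rw [hna, lastC_upN, mul_one]
        have e : ⟪gradient u x, upN f (epre x)⟫ - H0 =
            ((q - q0) * (U - u x) - q0 * (u x - u x1)) / γ := by
          rw [hH0, eq_div_iff hγ.ne', sub_mul, div_mul_cancel₀ _ hγ.ne', mul_comm, hrob]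
          ring
        rw [e, abs_div, abs_of_pos hγ, hEr, div_mul_eq_mul_div]
        refine div_le_div_of_nonneg_right ?_ hγ.le
        refine (abs_sub _ _).trans ?_
        rw [abs_mul, abs_mul, abs_of_nonneg hq00]
        have h5 : |q - q0| * |U - u x| ≤ c * ‖epre x - p0‖ * S :=
          mul_le_mul hq' (hUu x hxs) (abs_nonneg _) (by positivity)
        have h6 : q0 * |u x - u x1| ≤ Q * (2 * K / d0 * Q * ‖epre x - p0‖) :=
          mul_le_mul (hqQ p0) hgr (abs_nonneg _) hQ0
        have h7 : Q * (2 * K / d0 * Q * ‖epre x - p0‖) =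
            2 * K * (1 + c ^ 2) / d0 * ‖epre x - p0‖ := by
          rw [← hQ2]; ring
        have h8 := mul_le_mul_of_nonneg_left hxx
          (by positivity : 0 ≤ c * S + 2 * K * (1 + c ^ 2) / d0)
        linarith

end Local

section Global

variable {m : ℕ} {ε R0 γ c M U : ℝ} {f : E m → ℝ} {u : E (m+1) → ℝ}

/-- Reflection of the last coordinate as a continuous linear map. -/
def reflLin (m : ℕ) : E (m+1) →L[ℝ] E (m+1) :=
  LinearMap.mkContinuous
    { toFun := reflLast
      map_add' := fun x y => by
        ext i; refine Fin.lastCases ?_ (fun j => ?_) i <;> simp [reflLast, add_comm]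
      map_smul' := fun t x => by
        ext i; refine Fin.lastCases ?_ (fun j => ?_) i <;> simp [reflLast] } 1 fun x => by
    rw [one_mul]
    refine le_of_sq_le_sq (le_of_eq ?_) (norm_nonneg x)
    change ‖reflLast x‖ ^ 2 = _
    rw [norm_sq_eq_epre_lastC, norm_sq_eq_epre_lastC x, epre_reflLast, lastC_reflLast, neg_sq]

lemma OddRobin.norm_gradient_le_reflLast (h : OddRobin ε R0 γ c M U f u) {x : E (m+1)}
    (hx : x ∈ openSlab ε R0 f) : ‖gradient u x‖ ≤ ‖gradient u (reflLast x)‖ := by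
  have h1 : u =ᶠ[𝓝 x] fun y => -u (reflLin m y) := by
    filter_upwards [(isOpen_openSlab h.c11.continuous).mem_nhds hx] with y hy
    have : u (reflLin m y) = -u y := h.odd y hy
    rw [this, neg_neg]
  have h2 : HasFDerivAt u (fderiv ℝ u (reflLast x)) (reflLin m x) :=
    (h.diff _ (openSlab_subset_slab (reflLast_mem_openSlab hx))).hasFDerivAt
  have h3 := ((h2.comp x (reflLin m).hasFDerivAt).neg.congr_of_eventuallyEq h1).fderiv
  rw [← norm_gradient_eq, ← norm_gradient_eq, h3, norm_neg]
  refine (ContinuousLinearMap.opNorm_comp_le _ _).trans ?_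
  exact mul_le_of_le_one_right (norm_nonneg _)
    (LinearMap.mkContinuous_norm_le _ zero_le_one _)

lemma weighted_bound_le {n c γ S K d φ A h ρ κ R H : ℝ} (hn : 1 ≤ n) (hc : 0 < c) (hγ : 0 < γ)
    (hS : 0 ≤ S) (hK : 0 ≤ K) (hd : 0 < d) (hφ : 0 < φ) (hA : 0 ≤ A) (hh : 0 ≤ h) (hκ : 0 < κ)
    (hdR : d ≤ R) (hφH : φ ≤ H) (hκγ : κ * (640 * n * (1 + c ^ 2)) ≤ γ)
    (hρ : ρ = min κ (min (φ / (2 * (1 + c))) (d / 2))) :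
    d * (40 * n * (4 * ((c * S + 2 * K * (1 + c ^ 2) / d) / γ) * ρ + 2 * (2 * A * φ + h * ρ) / ρ)
      + h) ≤
    160 * n * κ * c * R / γ * S + 160 * n * A * (H * R / κ + 2 * (1 + c) * R + 2 * H) +
      (80 * n + 1) * R * h + K / 2 := by
  have hρ0 : 0 < ρ := by rw [hρ]; positivity
  have hρκ : ρ ≤ κ := by rw [hρ]; exact min_le_left _ _
  have hρi : φ * d / ρ ≤ H * R / κ + 2 * (1 + c) * R + 2 * H := by
    have hH : 0 ≤ H := hφ.le.trans hφH
    have h1 : φ * d / κ ≤ H * R / κ := by gcongr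
    have h2 : 2 * (1 + c) * d ≤ 2 * (1 + c) * R := by gcongr
    have h3 : 0 ≤ φ * d / κ := by positivity
    have h4 : 0 ≤ 2 * (1 + c) * d := by positivity
    suffices φ * d / ρ ≤ φ * d / κ + 2 * (1 + c) * d + 2 * φ by linarith
    rcases min_choice κ (min (φ / (2 * (1 + c))) (d / 2)) with e | e
    · rw [hρ, e]; linarith
    · rcases min_choice (φ / (2 * (1 + c))) (d / 2) with e' | e'
      · have : φ * d / ρ = 2 * (1 + c) * d := by rw [hρ, e, e']; field_simp
        linarith
      · have : φ * d / ρ = 2 * φ := by rw [hρ, e, e']; field_simp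
        linarith
  have e : d * (40 * n * (4 * ((c * S + 2 * K * (1 + c ^ 2) / d) / γ) * ρ +
      2 * (2 * A * φ + h * ρ) / ρ) + h) =
      160 * n * c * S / γ * (ρ * d) + 320 * n * (1 + c ^ 2) * K / γ * ρ +
        160 * n * A * (φ * d / ρ) + (80 * n + 1) * h * d := by
    field_simp
    ring
  have h1 : 160 * n * c * S / γ * (ρ * d) ≤ 160 * n * c * S / γ * (κ * R) := by gcongr
  have h2 : 320 * n * (1 + c ^ 2) * K / γ * ρ ≤ K / 2 := by
    have h3 : 320 * n * (1 + c ^ 2) * K / γ * ρ ≤ 320 * n * (1 + c ^ 2) * K / γ * κ := by gcongr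
    refine h3.trans ?_
    rw [div_mul_eq_mul_div, div_le_iff₀ hγ]
    nlinarith
  have h3 : 160 * n * A * (φ * d / ρ) ≤ 160 * n * A * (H * R / κ + 2 * (1 + c) * R + 2 * H) := by
    gcongr
  have h4 : (80 * n + 1) * h * d ≤ (80 * n + 1) * h * R := by gcongr
  have e1 : 160 * n * κ * c * R / γ * S = 160 * n * c * S / γ * (κ * R) := by ring
  rw [e, e1]
  linarith

/-- The gradient bound for odd solutions, with a constant depending only on `m, γ, R0, c`. -/
lemma exists_norm_gradient_le_of_oddRobin (m : ℕ) {γ R0 c : ℝ} (hγ : 0 < γ) (hR0 : 0 < R0)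
    (hc : 0 < c) : ∃ C : ℝ, 0 < C ∧ ∀ (ε M U : ℝ) (f : E m → ℝ) (u : E (m+1) → ℝ), 0 < M →
      OddRobin ε R0 γ c M U f u → ∀ x ∈ openSlab ε (R0 / 2) f,
        ‖gradient u x‖ ≤ C * (M + |U|) := by
  set n : ℝ := m + 1 with hn
  have hn1 : 1 ≤ n := by rw [hn]; linarith [(Nat.cast_nonneg m : (0:ℝ) ≤ m)]
  set Q := Real.sqrt (1 + c ^ 2) with hQ
  have hQp : 0 < Q := Real.sqrt_pos.2 (by positivity)
  set R := 3 * R0 / 4 with hR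
  set r := R0 / 8 with hr
  set H := R0 / 8 + c with hH
  set κ := min (1 / (16 * c)) (γ / (640 * n * (1 + c ^ 2))) with hκ
  have hκp : 0 < κ := by positivity
  have hκ1 : 16 * c * κ ≤ 1 := by
    have : κ ≤ 1 / (16 * c) := min_le_left _ _
    rw [le_div_iff₀ (by positivity)] at this
    linarith
  have hκγ : κ * (640 * n * (1 + c ^ 2)) ≤ γ := by
    have : κ ≤ γ / (640 * n * (1 + c ^ 2)) := min_le_right _ _
    rwa [le_div_iff₀ (by positivity)] at this
  set CA := Q / γ + (2 * n * H / r ^ 2 + 2 * c / r + 1) with hCA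
  have hrp : 0 < r := by positivity
  have hRp : 0 < R := by positivity
  have hHp : 0 < H := by positivity
  have hCAp : 0 < CA := by positivity
  set C2 := 160 * n * κ * c * R / γ + 160 * n * CA * (H * R / κ + 2 * (1 + c) * R + 2 * H) +
    (80 * n + 1) * R * (Q / γ) with hC2
  have hC2p : 0 < C2 := by positivity
  refine ⟨8 / R0 * C2, by positivity, fun ε M U f u hM h x hx => ?_⟩
  set S := M + |U| with hS
  have hSp : 0 < S := by positivity
  have hfH : ∀ p, ε / 2 + f p ≤ H := fun p => by
    have := (abs_le.1 (h.c11.2.1 p)).2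
    have := h.eps_lt
    linarith
  have hA : ∀ x : E (m+1), ‖epre x‖ ≤ R → -(ε / 2 + f (epre x)) < lastC x →
      lastC x ≤ ε / 2 + f (epre x) → |u x| ≤ CA * S * |lastC x| := fun x h1 h2 h3 => by
    refine h.abs_le_mul_lastC hγ hc hM hrp hfH ?_ (by linarith) h2 h3
    have e : Q * |U| / γ + 2 * (m + 1) * (M / r ^ 2) * H + 2 * (M / r ^ 2) * r * c + M =
        Q / γ * |U| + (2 * n * H / r ^ 2 + 2 * c / r + 1) * M := by
      field_simp
      rw [hn]
      ring
    rw [e]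
    have h4 : 0 ≤ Q / γ * M := by positivity
    have h5 : 0 ≤ (2 * n * H / r ^ 2 + 2 * c / r + 1) * |U| := by positivity
    rw [hCA, hS]
    linarith
  set T := {x : E (m+1) | ‖epre x‖ ≤ R ∧ |lastC x| ≤ ε / 2 + f (epre x)} with hT
  have hTc : IsCompact T := isCompact_closedSlab h.c11.continuous hfH
  have hTs : T ⊆ slab ε R0 f := fun x hx => ⟨by linarith [hx.1], hx.2⟩
  set w : E (m+1) → ℝ := fun x => (R - ‖epre x‖) * ‖gradient u x‖ with hw
  have hwc : ContinuousOn w (slab ε R0 f) :=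
    (continuous_const.sub continuous_epre.norm).continuousOn.mul h.cont.norm
  have hxT : x ∈ T := ⟨by linarith [hx.1], hx.2.le⟩
  obtain ⟨z, hzT, hmax⟩ := hTc.exists_isMaxOn ⟨x, hxT⟩ (hwc.mono hTs)
  have hmax' : ∀ y ∈ T, w y ≤ w z := fun y hy => hmax hy
  have hw0 : ∀ y ∈ T, 0 ≤ w y := fun y hy =>
    mul_nonneg (sub_nonneg.2 hy.1) (norm_nonneg _)
  have hupper : ∀ y ∈ openSlab ε R f, 0 ≤ lastC y → w y ≤ C2 * S + w z / 2 := by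
    intro y hy hy0
    have hd : 0 < R - ‖epre y‖ := sub_pos.2 hy.1
    have hφ : 0 < ε / 2 + f (epre y) := (abs_nonneg _).trans_lt hy.2
    set ρ := min κ (min ((ε / 2 + f (epre y)) / (2 * (1 + c))) ((R - ‖epre y‖) / 2)) with hρ
    have hρp : 0 < ρ := by positivity
    have hρ1 : 16 * c * ρ ≤ 1 :=
      (mul_le_mul_of_nonneg_left (min_le_left _ _) (by positivity)).trans hκ1
    have hρ2 : ρ ≤ (ε / 2 + f (epre y)) / (2 * (1 + c)) :=
      (min_le_right _ _).trans (min_le_left _ _)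
    have hρ3 : ρ ≤ (R - ‖epre y‖) / 2 := (min_le_right _ _).trans (min_le_right _ _)
    rw [le_div_iff₀ (by positivity)] at hρ2
    have h1 := h.norm_gradient_le_local hγ hc (R := R) (K := w z) (by linarith) hM
      (fun q hq1 hq2 => hmax' q ⟨hq1, hq2⟩) (by positivity) hA hy hy0 hρp hρ1
      (by linarith) (by linarith)
    have h2 := weighted_bound_le (A := CA * S) (h := Q * S / γ) hn1 hc hγ hSp.le (hw0 z hzT) hd hφ
      (by positivity) (by positivity) hκp (by linarith [norm_nonneg (epre y)] : _ ≤ R)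
      (hfH (epre y)) hκγ hρ
    refine (mul_le_mul_of_nonneg_left h1 hd.le).trans (h2.trans (le_of_eq ?_))
    rw [hC2]
    ring
  have hopen : ∀ y ∈ openSlab ε R f, w y ≤ C2 * S + w z / 2 := by
    intro y hy
    rcases le_total 0 (lastC y) with h0 | h0
    · exact hupper y hy h0
    · refine le_trans ?_ (hupper (reflLast y) (reflLast_mem_openSlab hy)
        (by rw [lastC_reflLast]; linarith))
      simp only [hw, epre_reflLast]
      exact mul_le_mul_of_nonneg_left
        (h.norm_gradient_le_reflLast ⟨by linarith [hy.1], hy.2⟩) (sub_nonneg.2 hy.1.le)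
  have hz : w z ≤ C2 * S + w z / 2 := by
    rcases hzT.1.lt_or_eq with hlt | heq
    · have hcl := slab_subset_closure_openSlab (R := R)
        (fun p hp => h.height_pos (hp.trans (by linarith))) ⟨hlt, hzT.2⟩
      exact ContinuousWithinAt.closure_le hcl
        ((hwc z (hTs hzT)).mono fun y hy => ⟨by linarith [hy.1], hy.2.le⟩)
        continuousWithinAt_const hopen
    · have : w z = 0 := by simp [hw, heq]
      rw [this]; positivity
  have h1 : R0 / 4 * ‖gradient u x‖ ≤ w x :=
    mul_le_mul_of_nonneg_right (by linarith [hx.1]) (norm_nonneg _)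
  have h2 := hmax' x hxT
  have h3 : R0 / 4 * ‖gradient u x‖ ≤ 2 * (C2 * S) := by linarith
  have e : 8 / R0 * C2 * S = 2 * (C2 * S) / (R0 / 4) := by field_simp; norm_num
  rw [e, le_div_iff₀ (by positivity)]
  linarith

lemma oddRobin_of_isLocalSol {γ R0 c1 c2 : ℝ} (hc1 : 0 < c1)
    {ε : ℝ} (hε : ε ∈ Set.Ioo (0:ℝ) (R0/4)) {f : E m → ℝ}
    (hf : FGSetting R0 c1 c2 f (fun p => -f p)) {u : E (m+1) → ℝ} {U : ℝ}
    (hu : IsLocalSol ε R0 γ f (fun p => -f p) u U (-U))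
    (hodd : ∀ x ∈ neck ε f (fun p => -f p) 0 R0, u (reflLast x) = -u x) {M : ℝ}
    (hM : ∀ y ∈ neck ε f (fun p => -f p) 0 R0, |u y| ≤ M) : OddRobin ε R0 γ c2 M U f u := by
  obtain ⟨hdiff, hcont, hC2, hharm, hrobin, -⟩ := hu
  have hc11 : C11 c2 f := hf.1
  have hnn : ∀ p, ‖p‖ < R0 → 0 ≤ f p := fun p hp => by
    have h1 := hf.2.2.2.2.2.2 p hp
    have h2 : 0 ≤ c1 * ‖p‖ ^ 2 := by positivity
    linarith
  have hpos : ∀ p, ‖p‖ < R0 → 0 < ε / 2 + f p := fun p hp => by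
    have := hnn p hp
    have := hε.1
    linarith
  have hsub : slab ε R0 f ⊆ regio ε R0 f (fun p => -f p) := slab_subset_regio hpos
  rw [neck_eq_openSlab] at hodd hM hC2 hharm
  have hd : ∀ x ∈ slab ε R0 f, DifferentiableAt ℝ u x := fun x hx => hdiff x (hsub hx)
  refine
    { eps_pos := hε.1
      eps_lt := hε.2
      c11 := hc11
      nonneg := hnn
      diff := hd
      cont := hcont.mono hsub
      contDiffAt := fun x hx => hC2.contDiffAt ((isOpen_openSlab hc11.continuous).mem_nhds hx)
      harmonic := hharm
      robin := fun x hx hxt => ?_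
      odd := hodd
      bound := fun x hx => ?_ }
  · have h1 := hrobin (epre x) (by simpa using hx)
    rw [← hxt, eglue_epre_lastC, nuP, real_inner_smul_left, real_inner_comm] at h1
    have hs : 0 < Real.sqrt (1 + ‖gradient f (epre x)‖ ^ 2) := Real.sqrt_pos.2 (by positivity)
    change u x + γ * (_ * ⟪gradient u x, upN f (epre x)⟫) = U at h1
    rw [← h1]
    field_simp
    ring
  · exact ContinuousWithinAt.closure_le (slab_subset_closure_openSlab hpos hx)
      (hd x hx).continuousAt.continuousWithinAt.abs continuousWithinAt_const hM

end Global

end Auxiliary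

/-- Corollary 1.4 (boundedness of the gradient in the symmetric odd case). -/
theorem gradient_bounded_symmetric (m : ℕ) (hm : 1 ≤ m) (γ R0 c1 c2 : ℝ)
    (hγ : 0 < γ) (hR0 : 0 < R0) (hc1 : 0 < c1) (hc2 : 0 < c2) :
    ∃ C : ℝ, 0 < C ∧
      ∀ ε ∈ Set.Ioo (0:ℝ) (R0/4), ∀ f g : E m → ℝ,
      g = (fun p => - f p) →
      FGSetting R0 c1 c2 f g →
      ∀ (u : E (m+1) → ℝ) (U1 : ℝ), IsLocalSol ε R0 γ f g u U1 (-U1) →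
      (∀ x ∈ neck ε f g 0 R0, u (reflLast x) = - u x) →
      ∀ M : ℝ, (∀ y ∈ neck ε f g 0 R0, |u y| ≤ M) →
      ∀ x ∈ neck ε f g 0 (R0/2),
        ‖gradient u x‖ ≤ C * (M + |U1|) := by
  obtain ⟨C, hC, hbound⟩ := exists_norm_gradient_le_of_oddRobin m hγ hR0 hc2
  refine ⟨C, hC, ?_⟩
  rintro ε hε f g rfl hfg u U1 hu hodd M hM x hx
  rw [neck_eq_openSlab] at hx
  have hM0 : 0 ≤ M := (abs_nonneg _).trans
    (hM x (by rw [neck_eq_openSlab]; exact ⟨by linarith [hx.1], hx.2⟩))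
  refine le_of_forall_pos_le_add fun η hη => ?_
  have hMη : 0 < M + η / C := by positivity
  have := hbound ε (M + η / C) U1 f u hMη
    (oddRobin_of_isLocalSol hc1 hε hfg hu hodd fun y hy => (hM y hy).trans (by
      have : 0 < η / C := by positivity
      linarith)) x hx
  calc ‖gradient u x‖ ≤ C * (M + η / C + |U1|) := this
    _ = C * (M + |U1|) + η := by field_simp; ring
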